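/- Let Q₁ and Q₂ be integral quadratic forms in n variables, nondegenerate over ℚ. Then Q₁ and Q₂ lie in the same genus — that is, Q₁ and Q₂ are equivalent over ℝ and over ℤ_p for every prime p — if and only if H ⊞ Q₁ and H ⊞ Q₂ are GL_{n+2}(ℤ)-equivalent, where H(x,y) = xy is the hyperbolic plane. -/

import Mathlib

open scoped BigOperators

/-- The quadratic form `Q(x) = ∑_{i ≤ j} a_{ij} x_i x_j` attached to the integer
coefficient matrix `a`, with variables in a commutative ring `R ⊇ ℤ`. -/
def QformR (R : Type*) [CommRing R] {n : ℕ} (a : Matrix (Fin n) (Fin n) ℤ)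
    (x : Fin n → R) : R :=
  ∑ i, ∑ j, if i ≤ j then (a i j : R) * x i * x j else 0

/-- The associated bilinear form of the integral form, over `ℤ`. -/
def Tbil {n : ℕ} (a : Matrix (Fin n) (Fin n) ℤ) (x y : Fin n → ℤ) : ℤ :=
  QformR ℤ a (x + y) - QformR ℤ a x - QformR ℤ a y

/-- The Gram matrix `[T] = (T(e_i, e_j))_{i,j}`. -/
def gram {n : ℕ} (a : Matrix (Fin n) (Fin n) ℤ) : Matrix (Fin n) (Fin n) ℤ :=
  Matrix.of fun i j => Tbil a (Pi.single i 1) (Pi.single j 1)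

/-- Two integral quadratic forms are equivalent over `R`: some `g ∈ GL_n(R)` carries one
to the other by the change of variables `x ↦ g⁻¹ x`. -/
def EquivOver (R : Type*) [CommRing R] {n : ℕ} (a b : Matrix (Fin n) (Fin n) ℤ) : Prop :=
  ∃ g : GL (Fin n) R, ∀ x : Fin n → R,
    QformR R b x = QformR R a (Matrix.mulVec (↑(g⁻¹) : Matrix (Fin n) (Fin n) R) x)

/-- The coefficient matrix of the orthogonal direct sum `H ⊞ Q`, where `H(x,y) = xy` is
the hyperbolic plane: two new variables with the single cross term `x₀ x₁`. -/
def Hplus {n : ℕ} (a : Matrix (Fin n) (Fin n) ℤ) : Matrix (Fin (2 + n)) (Fin (2 + n)) ℤ :=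
  (Matrix.fromBlocks !![0, 1; 0, 0] 0 0 a).submatrix finSumFinEquiv.symm finSumFinEquiv.symm


namespace GenusStab

open QuadraticMap

section Eichler

variable {R M M' : Type*} [CommRing R] [AddCommGroup M] [Module R M] [AddCommGroup M'] [Module R M']

/-- The hyperbolic plane `xy`. -/
def hyp (R : Type*) [CommRing R] : QuadraticForm R (R × R) :=
  QuadraticMap.linMulLin (LinearMap.fst R R R) (LinearMap.snd R R R)

theorem hyp_apply (v : R × R) : hyp R v = v.1 * v.2 := rfl

/-- `H ⊞ Q`. -/
abbrev hypSum (Q : QuadraticForm R M) : QuadraticForm R ((R × R) × M) := (hyp R).prod Q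

theorem hypSum_apply (Q : QuadraticForm R M) (v : (R × R) × M) :
    hypSum Q v = v.1.1 * v.1.2 + Q v.2 := rfl

theorem hypSum_polar (Q : QuadraticForm R M) (v w : (R × R) × M) :
    polar (hypSum Q) v w = v.1.1 * w.1.2 + v.1.2 * w.1.1 + polar Q v.2 w.2 := by
  simp only [polar, hypSum_apply, Prod.fst_add, Prod.snd_add]
  ring

/-- Eichler transformation, as a linear map. -/
def eichlerLin (Q : QuadraticForm R M) (w : M) : ((R × R) × M) →ₗ[R] ((R × R) × M) where
  toFun v := ((v.1.1 - v.1.2 * Q w - polar Q v.2 w, v.1.2), v.2 + v.1.2 • w)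
  map_add' := by
    intro u v
    ext <;> simp [polar_add_left, add_smul] <;> first | ring | abel
  map_smul' := by
    intro c v
    ext <;> simp [polar_smul_left, mul_smul]
    ring

theorem eichlerLin_apply (Q : QuadraticForm R M) (w : M) (v : (R × R) × M) :
    eichlerLin Q w v =
      ((v.1.1 - v.1.2 * Q w - polar Q v.2 w, v.1.2), v.2 + v.1.2 • w) := rfl

theorem eichlerLin_add (Q : QuadraticForm R M) (w w' : M) (v : (R × R) × M) :
    eichlerLin Q w (eichlerLin Q w' v) = eichlerLin Q (w + w') v := by
  have h := QuadraticMap.map_add Q w w'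
  simp only [eichlerLin_apply, polar_add_left, polar_smul_left, polar_add_right, smul_eq_mul, h,
    polar_comm Q w' w]
  refine Prod.ext (Prod.ext ?_ rfl) ?_
  · simp only; ring
  · simp only [smul_add]; abel

theorem eichlerLin_zero (Q : QuadraticForm R M) (v : (R × R) × M) :
    eichlerLin Q 0 v = v := by
  simp [eichlerLin_apply]

/-- Eichler transformation. -/
def eichler (Q : QuadraticForm R M) (w : M) : ((R × R) × M) ≃ₗ[R] ((R × R) × M) :=
  { eichlerLin Q w with
    invFun := eichlerLin Q (-w)
    left_inv := fun v => by
      change eichlerLin Q (-w) (eichlerLin Q w v) = v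
      rw [eichlerLin_add, neg_add_cancel, eichlerLin_zero]
    right_inv := fun v => by
      change eichlerLin Q w (eichlerLin Q (-w) v) = v
      rw [eichlerLin_add, add_neg_cancel, eichlerLin_zero] }

theorem eichler_apply (Q : QuadraticForm R M) (w : M) (v : (R × R) × M) :
    eichler Q w v =
      ((v.1.1 - v.1.2 * Q w - polar Q v.2 w, v.1.2), v.2 + v.1.2 • w) := rfl

theorem eichler_inv (Q : QuadraticForm R M) (w : M) : (eichler Q w)⁻¹ = eichler Q (-w) := by
  ext v <;> rfl

theorem eichler_isom (Q : QuadraticForm R M) (w : M) (v : (R × R) × M) :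
    hypSum Q (eichler Q w v) = hypSum Q v := by
  rw [eichler_apply, hypSum_apply, hypSum_apply]
  simp only
  rw [QuadraticMap.map_add Q, QuadraticMap.map_smul, polar_smul_right]
  simp only [smul_eq_mul]
  ring

/-- Swap of the two coordinates of the hyperbolic plane. -/
def hswap (R M : Type*) [CommRing R] [AddCommGroup M] [Module R M] :
    ((R × R) × M) ≃ₗ[R] ((R × R) × M) :=
  LinearEquiv.prodCongr (LinearEquiv.prodComm R R R) (LinearEquiv.refl R M)

theorem hswap_apply (v : (R × R) × M) : hswap R M v = ((v.1.2, v.1.1), v.2) := rfl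

theorem hswap_inv : (hswap R M)⁻¹ = hswap R M := by
  ext v <;> rfl

theorem hswap_isom (Q : QuadraticForm R M) (v : (R × R) × M) :
    hypSum Q (hswap R M v) = hypSum Q v := by
  rw [hypSum_apply, hypSum_apply, hswap_apply, mul_comm]

/-- Diagonal element of the hyperbolic plane. -/
def hdiag (M : Type*) [AddCommGroup M] [Module R M] (t : Rˣ) :
    ((R × R) × M) ≃ₗ[R] ((R × R) × M) :=
  LinearEquiv.prodCongr
    (LinearEquiv.prodCongr (LinearEquiv.smulOfUnit t) (LinearEquiv.smulOfUnit t⁻¹))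
    (LinearEquiv.refl R M)

theorem hdiag_apply (t : Rˣ) (v : (R × R) × M) :
    hdiag M t v = (((t : R) * v.1.1, ((t⁻¹ : Rˣ) : R) * v.1.2), v.2) := rfl

theorem hdiag_inv (t : Rˣ) : (hdiag M t)⁻¹ = hdiag M t⁻¹ := by
  ext v <;> rfl

theorem hdiag_mul (t s : Rˣ) : hdiag M (t * s) = hdiag M t * hdiag M s := by
  apply LinearEquiv.ext
  intro v
  simp only [LinearEquiv.mul_apply, hdiag_apply, Units.val_mul, mul_inv]
  ext <;> simp <;> ring

theorem hdiag_isom (Q : QuadraticForm R M) (t : Rˣ) (v : (R × R) × M) :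
    hypSum Q (hdiag M t v) = hypSum Q v := by
  simp only [hypSum_apply, hdiag_apply]
  have : (t : R) * ((t⁻¹ : Rˣ) : R) = 1 := by simp
  linear_combination (v.1.1 * v.1.2) * this

/-- The group generated by Eichler transformations, the swap and the torus. -/
def eoGroup (Q : QuadraticForm R M) : Subgroup (((R × R) × M) ≃ₗ[R] ((R × R) × M)) :=
  Subgroup.closure
    (Set.range (eichler Q) ∪ ({hswap R M} ∪ Set.range (fun t : Rˣ => hdiag M t)))

theorem eichler_mem (Q : QuadraticForm R M) (w : M) : eichler Q w ∈ eoGroup Q :=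
  Subgroup.subset_closure (Or.inl ⟨w, rfl⟩)

theorem hswap_mem (Q : QuadraticForm R M) : hswap R M ∈ eoGroup Q :=
  Subgroup.subset_closure (Or.inr (Or.inl rfl))

theorem hdiag_mem (Q : QuadraticForm R M) (t : Rˣ) : hdiag M t ∈ eoGroup Q :=
  Subgroup.subset_closure (Or.inr (Or.inr ⟨t, rfl⟩))

theorem eoGroup_isom (Q : QuadraticForm R M) {g : ((R × R) × M) ≃ₗ[R] ((R × R) × M)}
    (hg : g ∈ eoGroup Q) : ∀ v, hypSum Q (g v) = hypSum Q v := by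
  refine Subgroup.closure_induction (p := fun g _ => ∀ v, hypSum Q (g v) = hypSum Q v)
    ?_ ?_ ?_ ?_ hg
  · rintro _ (⟨w, rfl⟩ | rfl | ⟨t, rfl⟩) v
    · exact eichler_isom Q w v
    · exact hswap_isom Q v
    · exact hdiag_isom Q t v
  · intro v; rfl
  · intro x y _ _ hx hy v
    rw [LinearEquiv.mul_apply, hx, hy]
  · intro x _ hx v
    rw [← hx (x⁻¹ v), ← LinearEquiv.mul_apply, mul_inv_cancel]
    rfl

theorem isom_polar {Q : QuadraticForm R M} {Q' : QuadraticForm R M'} {g : M →ₗ[R] M'}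
    (h : ∀ v, Q' (g v) = Q v) (v w : M) : polar Q' (g v) (g w) = polar Q v w := by
  simp only [polar, ← map_add, h]

/-- If the `y`-coordinate is a unit, an isotropic vector can be moved to `e`. -/
theorem move_unit (Q : QuadraticForm R M) (v : (R × R) × M) (hv : hypSum Q v = 0)
    (hy : IsUnit v.1.2) : ∃ g ∈ eoGroup Q, g v = ((1, 0), 0) := by
  obtain ⟨t, ht⟩ := hy
  have h1 : (eichler Q (-((t⁻¹ : Rˣ) : R) • v.2) v).2 = 0 := by
    simp [eichler_apply, ← ht, smul_smul]
  have h2 : (eichler Q (-((t⁻¹ : Rˣ) : R) • v.2) v).1.2 = t := by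
    simp [eichler_apply, ← ht]
  have h3 : (eichler Q (-((t⁻¹ : Rˣ) : R) • v.2) v).1.1 = 0 := by
    have := eichler_isom Q (-((t⁻¹ : Rˣ) : R) • v.2) v
    rw [hypSum_apply, h1, h2, hv] at this
    simpa using this
  refine ⟨hdiag M t⁻¹ * hswap R M * eichler Q (-((t⁻¹ : Rˣ) : R) • v.2), ?_, ?_⟩
  · exact mul_mem (mul_mem (hdiag_mem Q _) (hswap_mem Q)) (eichler_mem Q _)
  · simp only [LinearEquiv.mul_apply, hdiag_apply, hswap_apply, h1, h2, h3]
    simp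

theorem move_e [IsLocalRing R] (Q : QuadraticForm R M) (v w : (R × R) × M)
    (hv : hypSum Q v = 0) (hvw : polar (hypSum Q) v w = 1) :
    ∃ g ∈ eoGroup Q, g v = ((1, 0), 0) := by
  by_cases hy : IsUnit v.1.2
  · exact move_unit Q v hv hy
  by_cases hx : IsUnit v.1.1
  · obtain ⟨g, hg, h⟩ := move_unit Q (hswap R M v) (by rw [hswap_isom, hv]) hx
    exact ⟨g * hswap R M, mul_mem hg (hswap_mem Q), h⟩
  rw [hypSum_polar] at hvw
  have hmx : v.1.1 ∈ IsLocalRing.maximalIdeal R := hx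
  have hmy : v.1.2 ∈ IsLocalRing.maximalIdeal R := hy
  have hu : IsUnit (v.1.2 - v.1.1 * Q w.2 - polar Q v.2 w.2) := by
    have e1 : v.1.2 - v.1.1 * Q w.2 - polar Q v.2 w.2 =
      (v.1.2 - v.1.1 * Q w.2 + v.1.1 * w.1.2 + v.1.2 * w.1.1) - 1 := by
        linear_combination -hvw
    rw [e1]
    by_contra hcon
    have hm : v.1.2 - v.1.1 * Q w.2 + v.1.1 * w.1.2 + v.1.2 * w.1.1 ∈
        IsLocalRing.maximalIdeal R :=
      Ideal.add_mem _ (Ideal.add_mem _ (Ideal.sub_mem _ hmy (Ideal.mul_mem_right _ _ hmx))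
        (Ideal.mul_mem_right _ _ hmx)) (Ideal.mul_mem_right _ _ hmy)
    have hcon' : (v.1.2 - v.1.1 * Q w.2 + v.1.1 * w.1.2 + v.1.2 * w.1.1) - 1 ∈
        IsLocalRing.maximalIdeal R := hcon
    have h1 := Ideal.sub_mem _ hm hcon'
    rw [sub_sub_cancel] at h1
    exact (Ideal.ne_top_iff_one _).1 (IsLocalRing.maximalIdeal.isMaximal R).ne_top h1
  let k := hswap R M * eichler Q w.2 * hswap R M
  have hk : k ∈ eoGroup Q := mul_mem (mul_mem (hswap_mem Q) (eichler_mem Q _)) (hswap_mem Q)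
  obtain ⟨g, hg, h⟩ := move_unit Q (k v) (by rw [eoGroup_isom Q hk, hv]) hu
  exact ⟨g * k, mul_mem hg hk, h⟩

theorem move_pair [IsLocalRing R] (Q : QuadraticForm R M) (v w : (R × R) × M)
    (hv : hypSum Q v = 0) (hw : hypSum Q w = 0) (hvw : polar (hypSum Q) v w = 1) :
    ∃ g ∈ eoGroup Q, g v = ((1, 0), 0) ∧ g w = ((0, 1), 0) := by
  obtain ⟨g, hg, h⟩ := move_e Q v w hv hvw
  have hw' : hypSum Q (g w) = 0 := by rw [eoGroup_isom Q hg, hw]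
  have hp : polar (hypSum Q) (g v) (g w) = 1 := by
    rw [← hvw]; exact isom_polar (g := g.toLinearMap) (eoGroup_isom Q hg) v w
  rw [h, hypSum_polar] at hp
  simp at hp
  rw [hypSum_apply, hp] at hw'
  refine ⟨eichler Q (-(g w).2) * g, mul_mem (eichler_mem Q _) hg, ?_, ?_⟩
  · rw [LinearEquiv.mul_apply, h, eichler_apply]; simp
  · rw [LinearEquiv.mul_apply, eichler_apply]
    simp only [hp, one_smul, add_neg_cancel, one_mul, QuadraticMap.map_neg, polar_neg_right,
      polar_self]
    refine Prod.ext (Prod.ext ?_ rfl) rfl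
    simp only [nsmul_eq_mul]
    push_cast
    linear_combination hw'

/-- Cancellation of a hyperbolic plane over a local ring. -/
theorem hyp_cancel [IsLocalRing R] (Q : QuadraticForm R M) (Q' : QuadraticForm R M')
    (h : (hypSum Q).Equivalent (hypSum Q')) : Q.Equivalent Q' := by
  obtain ⟨f⟩ := h
  have hf : ∀ v, hypSum Q' (f v) = hypSum Q v := f.map_app
  have hpol : ∀ v w, polar (hypSum Q') (f v) (f w) = polar (hypSum Q) v w :=
    isom_polar (g := f.toLinearEquiv.toLinearMap) hf
  obtain ⟨g, hg, h1, h2⟩ := move_pair Q' (f ((1, 0), 0)) (f ((0, 1), 0))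
    (by rw [hf, hypSum_apply]; simp) (by rw [hf, hypSum_apply]; simp)
    (by rw [hpol, hypSum_polar]; simp)
  let k : ((R × R) × M) ≃ₗ[R] ((R × R) × M') := f.toLinearEquiv.trans g
  have hk : ∀ v, hypSum Q' (k v) = hypSum Q v := fun v => by
    change hypSum Q' (g (f v)) = _
    rw [eoGroup_isom Q' hg, hf]
  have hkp : ∀ v w, polar (hypSum Q') (k v) (k w) = polar (hypSum Q) v w :=
    isom_polar (g := k.toLinearMap) hk
  have k1 : k ((1, 0), 0) = ((1, 0), 0) := h1
  have k2 : k ((0, 1), 0) = ((0, 1), 0) := h2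
  have key : ∀ m : M, k (0, m) = (0, (k (0, m)).2) := by
    intro m
    have a1 := hkp (0, m) ((1, 0), 0)
    have a2 := hkp (0, m) ((0, 1), 0)
    rw [k1, hypSum_polar, hypSum_polar] at a1
    rw [k2, hypSum_polar, hypSum_polar] at a2
    simp at a1 a2
    exact Prod.ext (Prod.ext a2 a1) rfl
  have k1' : k.symm ((1, 0), 0) = ((1, 0), 0) := by rw [LinearEquiv.symm_apply_eq, k1]
  have k2' : k.symm ((0, 1), 0) = ((0, 1), 0) := by rw [LinearEquiv.symm_apply_eq, k2]
  have hks : ∀ v w, polar (hypSum Q) (k.symm v) (k.symm w) = polar (hypSum Q') v w := by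
    intro v w
    rw [← hkp]; simp
  have key' : ∀ m : M', k.symm (0, m) = (0, (k.symm (0, m)).2) := by
    intro m
    have a1 := hks (0, m) ((1, 0), 0)
    have a2 := hks (0, m) ((0, 1), 0)
    rw [k1', hypSum_polar, hypSum_polar] at a1
    rw [k2', hypSum_polar, hypSum_polar] at a2
    simp at a1 a2
    exact Prod.ext (Prod.ext a2 a1) rfl
  refine ⟨⟨LinearEquiv.ofLinearMap (LinearMap.snd R _ _ ∘ₗ k.toLinearMap ∘ₗ LinearMap.inr R (R × R) M)
    (LinearMap.snd R _ _ ∘ₗ k.symm.toLinearMap ∘ₗ LinearMap.inr R (R × R) M') ?_ ?_, ?_⟩⟩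
  · ext m
    simp only [LinearMap.coe_comp, Function.comp_apply, LinearMap.inr_apply, LinearMap.snd_apply,
      LinearEquiv.coe_coe, LinearMap.id_apply]
    rw [← key' m]; simp
  · ext m
    simp only [LinearMap.coe_comp, Function.comp_apply, LinearMap.inr_apply, LinearMap.snd_apply,
      LinearEquiv.coe_coe, LinearMap.id_apply]
    rw [← key m]; simp
  · intro m
    change Q' (k (0, m)).2 = Q m
    have := hk (0, m)
    rw [key m, hypSum_apply, hypSum_apply] at this
    simpa using this

end Eichler

end GenusStab


namespace GenusStab

open QuadraticMap

section Diag

variable {F : Type*} [Field F]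

/-- The diagonal quadratic form attached to a list of units. -/
noncomputable def D (l : List Fˣ) : QuadraticForm F (Fin l.length → F) :=
  weightedSumSquares F (fun i => ((l.get i : Fˣ) : F))

theorem D_apply (l : List Fˣ) (v : Fin l.length → F) :
    D l v = ∑ i, ((l.get i : Fˣ) : F) * (v i * v i) := by
  simp [D, weightedSumSquares_apply]

theorem D_cons_apply (a : Fˣ) (l : List Fˣ) (v : Fin (a :: l).length → F) :
    D (a :: l) v = a * (v 0 * v 0) + D l (fun i => v i.succ) := by
  rw [D_apply, D_apply]
  exact Fin.sum_univ_succ _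

/-- unary form -/
noncomputable def una (a : F) : QuadraticForm F F := a • QuadraticMap.sq

theorem una_apply (a x : F) : una a x = a * (x * x) := by simp [una]

theorem D_cons (a : Fˣ) (l : List Fˣ) : (D (a :: l)).Equivalent ((una (a : F)).prod (D l)) := by
  refine ⟨⟨(Fin.consLinearEquiv F (fun _ : Fin (l.length + 1) => F)).symm, ?_⟩⟩
  intro v
  rw [D_cons_apply, QuadraticMap.prod_apply, una_apply]
  rfl

/-- binary form -/
noncomputable def bin (a b : F) : QuadraticForm F (F × F) := (una a).prod (una b)

theorem bin_apply (a b : F) (v : F × F) : bin a b v = a * (v.1 * v.1) + b * (v.2 * v.2) := by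
  simp [bin, una_apply]

theorem D_cons_cons (a b : Fˣ) (l : List Fˣ) :
    (D (a :: b :: l)).Equivalent ((bin (a : F) b).prod (D l)) := by
  refine (D_cons a (b :: l)).trans (((Equivalent.refl _).prod (D_cons b l)).trans ?_)
  refine ⟨⟨(LinearEquiv.prodAssoc F _ _ _).symm, ?_⟩⟩
  intro v
  change una (a : F) v.1 + una (b : F) v.2.1 + D l v.2.2 =
    una (a : F) v.1 + (una (b : F) v.2.1 + D l v.2.2)
  rw [add_assoc]

/-- Isometry of lists. -/
def Iso (l l' : List Fˣ) : Prop := (D l).Equivalent (D l')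

theorem Iso.refl (l : List Fˣ) : Iso l l := Equivalent.refl _
theorem Iso.symm {l l' : List Fˣ} (h : Iso l l') : Iso l' l := Equivalent.symm h
theorem Iso.trans {l l' l'' : List Fˣ} (h : Iso l l') (h' : Iso l' l'') : Iso l l'' :=
  Equivalent.trans h h'

theorem Iso.cons (a : Fˣ) {l l' : List Fˣ} (h : Iso l l') : Iso (a :: l) (a :: l') :=
  (D_cons a l).trans (((Equivalent.refl _).prod h).trans (D_cons a l').symm)

theorem Iso.of_bin {a b c d : Fˣ} (h : (bin (a : F) b).Equivalent (bin (c : F) d))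
    (l : List Fˣ) : Iso (a :: b :: l) (c :: d :: l) :=
  (D_cons_cons a b l).trans ((h.prod (Equivalent.refl _)).trans (D_cons_cons c d l).symm)

theorem bin_swap (a b : F) : (bin a b).Equivalent (bin b a) := by
  refine ⟨⟨LinearEquiv.prodComm F F F, ?_⟩⟩
  intro v
  simp [bin_apply, add_comm]

theorem Iso.of_perm {l l' : List Fˣ} (h : l.Perm l') : Iso l l' := by
  induction h with
  | nil => exact Iso.refl _
  | cons a _ ih => exact ih.cons a
  | swap a b l => exact Iso.of_bin (bin_swap _ _) l
  | trans _ _ h1 h2 => exact h1.trans h2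

theorem Iso.append_left (m : List Fˣ) {l l' : List Fˣ} (h : Iso l l') :
    Iso (m ++ l) (m ++ l') := by
  induction m with
  | nil => exact h
  | cons a m ih => exact ih.cons a

theorem Iso.append_right (m : List Fˣ) {l l' : List Fˣ} (h : Iso l l') :
    Iso (l ++ m) (l' ++ m) :=
  (Iso.of_perm List.perm_append_comm).trans
    ((h.append_left m).trans (Iso.of_perm List.perm_append_comm))

theorem Iso.append {l l' m m' : List Fˣ} (h : Iso l l') (h' : Iso m m') :
    Iso (l ++ m) (l' ++ m') :=
  (h.append_right m).trans (h'.append_left l')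

theorem una_sq (a b : Fˣ) : (una ((a * b ^ 2 : Fˣ) : F)).Equivalent (una (a : F)) := by
  refine ⟨⟨LinearEquiv.smulOfUnit b, ?_⟩⟩
  intro v
  change una (a : F) ((b : F) * v) = una ((a * b ^ 2 : Fˣ) : F) v
  simp [una_apply]; ring

theorem Iso.sq (a b : Fˣ) (l : List Fˣ) : Iso ((a * b ^ 2) :: l) (a :: l) :=
  (D_cons _ l).trans (((una_sq a b).prod (Equivalent.refl _)).trans (D_cons a l).symm)

theorem bin_add {a b c : Fˣ} (h : (c : F) = a + b) :
    (bin (a : F) b).Equivalent (bin (c : F) ((a * b * c : Fˣ) : F)) := by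
  have hc : (a : F) + b ≠ 0 := h ▸ c.ne_zero
  refine ⟨⟨⟨⟨⟨fun v => ((a * v.1 + b * v.2) / (a + b), (v.1 - v.2) / (a + b)), ?_⟩, ?_⟩,
    fun v => (v.1 + b * v.2, v.1 - a * v.2), ?_, ?_⟩, ?_⟩⟩
  · intro v w; ext <;> simp <;> field_simp <;> ring
  · intro r v; ext <;> simp <;> field_simp
  · intro v; ext <;> simp <;> field_simp <;> ring
  · intro v; ext <;> simp <;> field_simp <;> ring
  · intro v
    simp [bin_apply, h]
    field_simp
    ring

variable [NeZero (2 : F)]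

theorem bin_hyp (a : Fˣ) : (bin (a : F) ((-a : Fˣ) : F)).Equivalent (hyp F) := by
  have h2 : (2 : F) ≠ 0 := NeZero.ne _
  have ha : (a : F) ≠ 0 := a.ne_zero
  refine ⟨⟨⟨⟨⟨fun v => (a * (v.1 + v.2), v.1 - v.2), ?_⟩, ?_⟩,
    fun v => ((v.1 / a + v.2) / 2, (v.1 / a - v.2) / 2), ?_, ?_⟩, ?_⟩⟩
  · intro v w; ext <;> simp <;> ring
  · intro r v; ext <;> simp <;> ring
  · intro v; ext <;> simp
  · intro v; ext <;> simp <;> field_simp <;> ring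
  · intro v
    simp [bin_apply, hyp_apply]
    ring

theorem D_hyp (a : Fˣ) (l : List Fˣ) : (D (a :: -a :: l)).Equivalent (hypSum (D l)) :=
  (D_cons_cons a (-a) l).trans ((bin_hyp a).prod (Equivalent.refl _))

theorem Iso.hyp (a b : Fˣ) (l : List Fˣ) : Iso (a :: -a :: l) (b :: -b :: l) :=
  (D_hyp a l).trans (D_hyp b l).symm

theorem Iso.cancel (a : Fˣ) {l l' : List Fˣ} (h : Iso (a :: l) (a :: l')) : Iso l l' := by
  have h1 : Iso (-a :: a :: l) (-a :: a :: l') := h.cons (-a)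
  have e : ∀ m : List Fˣ, (D (-a :: a :: m)).Equivalent (hypSum (D m)) := by
    intro m
    have := D_hyp (-a) m
    rwa [neg_neg] at this
  exact hyp_cancel _ _ ((e l).symm.trans (Equivalent.trans h1 (e l')))

theorem Iso.append_cancel (m : List Fˣ) {l l' : List Fˣ} (h : Iso (m ++ l) (m ++ l')) :
    Iso l l' := by
  induction m with
  | nil => exact h
  | cons a m ih => exact ih (Iso.cancel a h)

end Diag

section GW

/-- Free abelian group on units -/
abbrev FA (F : Type*) [Field F] := FreeAbelianGroup Fˣ

/-- generator -/
abbrev gen {F : Type*} [Field F] (a : Fˣ) : FA F := FreeAbelianGroup.of a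

variable {F : Type*} [Field F]

/-- The class of a list -/
def cls (l : List Fˣ) : FA F := (l.map gen).sum

@[simp] theorem cls_nil : cls ([] : List Fˣ) = 0 := rfl
@[simp] theorem cls_cons (a : Fˣ) (l : List Fˣ) : cls (a :: l) = gen a + cls l := by simp [cls]
@[simp] theorem cls_append (l m : List Fˣ) : cls (l ++ m) = cls l + cls m := by simp [cls]

/-- The defining relations of the Grothendieck-Witt group. -/
inductive GWRel (F : Type*) [Field F] : FA F → Prop
  | sq (a b : Fˣ) : GWRel F (gen (a * b ^ 2) - gen a)
  | add (a b c : Fˣ) (h : (c : F) = a + b) : GWRel F (gen a + gen b - gen c - gen (a * b * c))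
  | hyp (a : Fˣ) : GWRel F (gen a + gen (-a) - gen 1 - gen (-1))

/-- The subgroup of relations. -/
def Rel (F : Type*) [Field F] : AddSubgroup (FA F) := AddSubgroup.closure {x | GWRel F x}

theorem Rel_le {A : AddSubgroup (FA F)} (h1 : ∀ a b : Fˣ, gen (a * b ^ 2) - gen a ∈ A)
    (h2 : ∀ a b c : Fˣ, (c : F) = a + b → gen a + gen b - gen c - gen (a * b * c) ∈ A)
    (h3 : ∀ a : Fˣ, gen a + gen (-a) - gen 1 - gen (-1) ∈ A) : Rel F ≤ A := by
  rw [Rel, AddSubgroup.closure_le]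
  rintro _ (⟨a, b⟩ | ⟨a, b, c, h⟩ | ⟨a⟩)
  · exact h1 a b
  · exact h2 a b c h
  · exact h3 a

theorem Rel.sq (a b : Fˣ) : gen (a * b ^ 2) - gen a ∈ Rel F :=
  AddSubgroup.subset_closure (GWRel.sq a b)
theorem Rel.add (a b c : Fˣ) (h : (c : F) = a + b) :
    gen a + gen b - gen c - gen (a * b * c) ∈ Rel F :=
  AddSubgroup.subset_closure (GWRel.add a b c h)
theorem Rel.hyp (a : Fˣ) : gen a + gen (-a) - gen 1 - gen (-1) ∈ Rel F :=
  AddSubgroup.subset_closure (GWRel.hyp a)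

theorem perm_of_cls_eq {l m : List Fˣ} (h : cls l = cls m) : l.Perm m := by
  classical
  rw [List.perm_iff_count]
  intro a
  let f : FA F →+ ℤ := FreeAbelianGroup.lift (fun b => if b = a then 1 else 0)
  have key : ∀ l : List Fˣ, f (cls l) = l.count a := by
    intro l
    induction l with
    | nil => simp
    | cons b l ih =>
      rw [cls_cons, map_add, ih, List.count_cons]
      simp only [f, FreeAbelianGroup.lift_apply_of]
      by_cases hb : b = a <;> simp [hb, add_comm]
  have := congrArg f h
  rw [key, key] at this
  exact_mod_cast this

variable [NeZero (2 : F)]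

/-- Isometry subgroup. -/
def isoSub (F : Type*) [Field F] [NeZero (2 : F)] : AddSubgroup (FA F) where
  carrier := {x | ∃ l m : List Fˣ, Iso l m ∧ x = cls l - cls m}
  zero_mem' := ⟨[], [], Iso.refl _, by simp⟩
  add_mem' := by
    rintro _ _ ⟨l, m, h, rfl⟩ ⟨l', m', h', rfl⟩
    exact ⟨l ++ l', m ++ m', h.append h', by simp; abel⟩
  neg_mem' := by
    rintro _ ⟨l, m, h, rfl⟩
    exact ⟨m, l, h.symm, by simp⟩

theorem Rel_le_isoSub : Rel F ≤ isoSub F := by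
  refine Rel_le ?_ ?_ ?_
  · intro a b
    exact ⟨[a * b ^ 2], [a], Iso.sq a b [], by simp⟩
  · intro a b c h
    exact ⟨[a, b], [c, a * b * c], Iso.of_bin (bin_add h) [], by simp; abel⟩
  · intro a
    exact ⟨[a, -a], [1, -1], Iso.hyp a 1 [], by simp; abel⟩

/-- Theorem B: equality in the Grothendieck-Witt group implies isometry. -/
theorem iso_of_rel {l l' : List Fˣ} (h : cls l - cls l' ∈ Rel F) : Iso l l' := by
  obtain ⟨m, m', hm, e⟩ := Rel_le_isoSub h
  have e' : cls (m' ++ l) = cls (m ++ l') := by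
    simp only [cls_append]
    rw [← sub_eq_zero] at e ⊢
    rw [← e]; abel
  have hp := Iso.of_perm (perm_of_cls_eq e')
  exact Iso.append_cancel m' (hp.trans (hm.append_right l'))

theorem rel_repr (l : List Fˣ) : ∀ (v : Fin l.length → F) (b : Fˣ), D l v = b →
    ∃ m : List Fˣ, cls l - cls (b :: m) ∈ Rel F := by
  induction l with
  | nil =>
    intro v b h
    rw [D_apply] at h
    simp at h
    exact absurd h.symm b.ne_zero
  | cons a t ih =>
    intro v b h
    rw [D_cons_apply] at h
    set s := D t (fun i => v i.succ) with hs
    by_cases hx : v 0 = 0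
    · rw [hx] at h
      simp only [mul_zero, zero_add] at h
      obtain ⟨m, hm⟩ := ih _ b h
      refine ⟨a :: m, ?_⟩
      convert hm using 1
      simp; abel
    let x : Fˣ := Units.mk0 (v 0) hx
    have hsq := Rel.sq a x
    by_cases h0 : s = 0
    · have hb : b = a * x ^ 2 := by
        ext
        rw [← h, h0]
        simp [x, pow_two]
      refine ⟨t, ?_⟩
      rw [hb]
      convert neg_mem hsq using 1
      simp
    · let s' : Fˣ := Units.mk0 s h0
      obtain ⟨m, hm⟩ := ih _ s' rfl
      have hadd := Rel.add (a * x ^ 2) s' b (by rw [← h]; simp [x, s', pow_two])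
      refine ⟨(a * x ^ 2 * s' * b) :: m, ?_⟩
      convert add_mem (sub_mem hadd hsq) hm using 1
      simp only [cls_cons]
      abel

/-- Theorem A: isometry implies equality in the Grothendieck-Witt group. -/
theorem rel_of_iso (l' : List Fˣ) : ∀ l : List Fˣ, Iso l l' → cls l - cls l' ∈ Rel F := by
  induction l' with
  | nil =>
    rintro l ⟨f⟩
    have := f.toLinearEquiv.finrank_eq
    simp at this
    subst this
    simp [(Rel F).zero_mem]
  | cons b m' ih =>
    intro l h
    obtain ⟨f⟩ := h.symm
    have hv : D l (f (Pi.single 0 1)) = b := by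
      rw [f.map_app, D_cons_apply]
      have : (fun i : Fin m'.length => (Pi.single (0 : Fin (m'.length + 1)) (1 : F) :
          Fin (m'.length + 1) → F) i.succ) = 0 := by
        ext i; simp
      have e2 : (Pi.single (0 : Fin (b :: m').length) (1 : F) : Fin (b :: m').length → F) 0 = 1 := by
        simp
      rw [e2]
      erw [this]
      simp
    obtain ⟨m, hm⟩ := rel_repr l _ b hv
    have h1 : Iso (b :: m) (b :: m') := (iso_of_rel hm).symm.trans h
    have h2 := ih m (Iso.cancel b h1)
    convert add_mem hm h2 using 1
    simp only [cls_cons]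
    abel

end GW

end GenusStab


namespace GenusStab

section Witt

variable (F : Type*) [Field F]

/-- The defining relations of the (combinatorial) Witt group. -/
def RelW : AddSubgroup (FA F) :=
  Rel F ⊔ AddSubgroup.closure (Set.range (fun a : Fˣ => (gen a + gen (-a) : FA F)))

/-- combinatorial Witt group -/
abbrev WG := FA F ⧸ RelW F

variable {F}

/-- generator of the Witt group -/
def wgen (a : Fˣ) : WG F := QuotientAddGroup.mk (gen a)

theorem wgen_sq (a b : Fˣ) : wgen (a * b ^ 2) = wgen a := by
  rw [wgen, wgen, ← sub_eq_zero, ← QuotientAddGroup.mk_sub, QuotientAddGroup.eq_zero_iff]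
  exact AddSubgroup.mem_sup_left (Rel.sq a b)

theorem wgen_add (a b c : Fˣ) (h : (c : F) = a + b) :
    wgen a + wgen b = wgen c + wgen (a * b * c) := by
  rw [wgen, wgen, wgen, wgen, ← sub_eq_zero, ← QuotientAddGroup.mk_add, ← QuotientAddGroup.mk_add,
    ← QuotientAddGroup.mk_sub, QuotientAddGroup.eq_zero_iff, ← sub_sub]
  exact AddSubgroup.mem_sup_left (Rel.add a b c h)

theorem wgen_neg (a : Fˣ) : wgen a + wgen (-a) = 0 := by
  rw [wgen, wgen, ← QuotientAddGroup.mk_add, QuotientAddGroup.eq_zero_iff]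
  exact AddSubgroup.mem_sup_right (AddSubgroup.subset_closure ⟨a, rfl⟩)

theorem RelW_le {A : AddSubgroup (FA F)} (h1 : ∀ a b : Fˣ, gen (a * b ^ 2) - gen a ∈ A)
    (h2 : ∀ a b c : Fˣ, (c : F) = a + b → gen a + gen b - gen c - gen (a * b * c) ∈ A)
    (h3 : ∀ a : Fˣ, gen a + gen (-a) ∈ A) : RelW F ≤ A := by
  refine sup_le (Rel_le h1 h2 ?_) ?_
  · intro a
    convert sub_mem (h3 a) (h3 1) using 1
    abel
  · rw [AddSubgroup.closure_le]
    rintro _ ⟨a, rfl⟩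
    exact h3 a

end Witt

section Local

variable {p : ℕ} [hp : Fact p.Prime]

theorem p_ne : ((p : ℕ) : ℚ_[p]) ≠ 0 := by exact_mod_cast hp.out.ne_zero

/-- valuation of a unit -/
noncomputable def val (a : ℚ_[p]ˣ) : ℤ := (a : ℚ_[p]).valuation

theorem norm_unitPart (a : ℚ_[p]ˣ) : ‖(a : ℚ_[p]) * (p : ℚ_[p]) ^ (-val a)‖ = 1 := by
  rw [norm_mul, Padic.norm_p_zpow, neg_neg, Padic.norm_eq_zpow_neg_valuation a.ne_zero, val,
    ← zpow_add₀ (by exact_mod_cast hp.out.ne_zero)]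
  simp

/-- unit part -/
noncomputable def upart (a : ℚ_[p]ˣ) : ℤ_[p]ˣ := PadicInt.mkUnits (norm_unitPart a)

theorem eq_upart (a : ℚ_[p]ˣ) :
    (a : ℚ_[p]) = (p : ℚ_[p]) ^ (val a) * ((upart a : ℤ_[p]) : ℚ_[p]) := by
  change (a : ℚ_[p]) = (p : ℚ_[p]) ^ (val a) * ((a : ℚ_[p]) * (p : ℚ_[p]) ^ (-val a))
  rw [mul_comm (a : ℚ_[p]), ← mul_assoc, ← zpow_add₀ p_ne]
  simp

/-- leading coefficient -/
noncomputable def lead (a : ℚ_[p]ˣ) : (ZMod p)ˣ :=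
  Units.map (PadicInt.toZMod (p := p)).toMonoidHom (upart a)

theorem lead_coe (a : ℚ_[p]ˣ) : (lead a : ZMod p) = PadicInt.toZMod (upart a : ℤ_[p]) := rfl

theorem toZMod_p : PadicInt.toZMod ((p : ℕ) : ℤ_[p]) = 0 := by
  rw [map_natCast]; simp

theorem compare (j k : ℤ) (z : ℤ_[p]ˣ) (t : ℤ_[p])
    (h : (p : ℚ_[p]) ^ j * ((z : ℤ_[p]) : ℚ_[p]) = (p : ℚ_[p]) ^ k * (t : ℚ_[p])) :
    (j = k ∧ (z : ℤ_[p]) = t) ∨ (k < j ∧ PadicInt.toZMod t = 0) := by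
  have ht : (t : ℚ_[p]) = (p : ℚ_[p]) ^ (j - k) * ((z : ℤ_[p]) : ℚ_[p]) := by
    rw [zpow_sub₀ p_ne]
    field_simp [zpow_ne_zero k (p_ne (p := p))]
    rw [h]
    ring
  have hz : ‖((z : ℤ_[p]) : ℚ_[p])‖ = 1 := by
    rw [← PadicInt.norm_def]; exact PadicInt.isUnit_iff.1 z.isUnit
  have hn : ‖(t : ℚ_[p])‖ = (p : ℝ) ^ (-(j - k)) := by
    rw [ht, norm_mul, hz, Padic.norm_p_zpow, mul_one]
  have h1 : (p : ℝ) ^ (-(j - k)) ≤ (p : ℝ) ^ (0 : ℤ) := by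
    rw [← hn, zpow_zero, ← PadicInt.norm_def]; exact PadicInt.norm_le_one t
  have hp1 : (1 : ℝ) < p := by exact_mod_cast hp.out.one_lt
  have h2 := (zpow_le_zpow_iff_right₀ hp1).1 h1
  rcases eq_or_lt_of_le (show k ≤ j by lia) with hjk | hjk
  · left
    refine ⟨hjk.symm, ?_⟩
    rw [hjk, sub_self, zpow_zero, one_mul] at ht
    exact (Subtype.ext ht).symm
  · right
    refine ⟨hjk, ?_⟩
    obtain ⟨n, hn⟩ : ∃ n : ℕ, j - k = n + 1 := ⟨(j - k - 1).toNat, by lia⟩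
    have : t = (p : ℤ_[p]) ^ (n + 1) * (z : ℤ_[p]) := by
      apply Subtype.ext
      change (t : ℚ_[p]) = _
      rw [ht, hn]
      push_cast
      norm_cast
    rw [this, map_mul, map_pow, toZMod_p]
    simp

theorem uniq (a : ℚ_[p]ˣ) (k : ℤ) (t : ℤ_[p]ˣ) (h : (a : ℚ_[p]) = (p : ℚ_[p]) ^ k * (t : ℤ_[p])) :
    val a = k ∧ upart a = t := by
  rw [eq_upart a] at h
  rcases compare _ _ _ _ h with ⟨h1, h2⟩ | ⟨h1, h2⟩
  · exact ⟨h1, Units.ext h2⟩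
  · have : IsUnit (PadicInt.toZMod (t : ℤ_[p])) := t.isUnit.map _
    rw [h2] at this
    simp at this

theorem val_lead (a : ℚ_[p]ˣ) (k : ℤ) (t : ℤ_[p]ˣ)
    (h : (a : ℚ_[p]) = (p : ℚ_[p]) ^ k * (t : ℤ_[p])) :
    val a = k ∧ (lead a : ZMod p) = PadicInt.toZMod (t : ℤ_[p]) := by
  obtain ⟨h1, h2⟩ := uniq a k t h
  exact ⟨h1, by rw [lead_coe, h2]⟩

theorem val_mul (a b : ℚ_[p]ˣ) : val (a * b) = val a + val b :=
  Padic.valuation_mul a.ne_zero b.ne_zero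

theorem lead_mul (a b : ℚ_[p]ˣ) : lead (a * b) = lead a * lead b := by
  have := val_lead (a * b) (val a + val b) (upart a * upart b) (by
    push_cast
    rw [zpow_add₀ p_ne]
    conv_lhs => rw [eq_upart a, eq_upart b]
    ring)
  ext
  rw [this.2]
  simp [lead_coe]

theorem val_one : val (1 : ℚ_[p]ˣ) = 0 := by
  have := val_mul (1 : ℚ_[p]ˣ) 1
  rw [mul_one] at this; lia

theorem lead_one : lead (1 : ℚ_[p]ˣ) = 1 := by
  have := lead_mul (1 : ℚ_[p]ˣ) 1
  rw [mul_one] at this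
  simpa using this

theorem val_inv (a : ℚ_[p]ˣ) : val a⁻¹ = - val a := by
  have := val_mul a a⁻¹
  rw [mul_inv_cancel, val_one] at this; lia

theorem lead_inv (a : ℚ_[p]ˣ) : lead a⁻¹ = (lead a)⁻¹ := by
  have := lead_mul a a⁻¹
  rw [mul_inv_cancel, lead_one] at this
  exact (inv_eq_of_mul_eq_one_right this.symm).symm

theorem val_zpow (a : ℚ_[p]ˣ) (k : ℤ) : val (a ^ k) = k * val a := by
  let f : ℚ_[p]ˣ →* Multiplicative ℤ :=
    { toFun := fun a => Multiplicative.ofAdd (val a)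
      map_one' := by rw [val_one]; rfl
      map_mul' := fun a b => by rw [val_mul]; rfl }
  have := map_zpow f a k
  have h2 := congrArg Multiplicative.toAdd this
  simpa [f] using h2

theorem lead_zpow (a : ℚ_[p]ˣ) (k : ℤ) : lead (a ^ k) = lead a ^ k := by
  let f : ℚ_[p]ˣ →* (ZMod p)ˣ :=
    { toFun := lead
      map_one' := lead_one
      map_mul' := lead_mul }
  exact map_zpow f a k

theorem val_neg (a : ℚ_[p]ˣ) : val (-a) = val a := by
  have := val_lead (-a) (val a) (-upart a) (by
    push_cast
    conv_lhs => rw [eq_upart a]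
    ring)
  exact this.1

theorem lead_neg (a : ℚ_[p]ˣ) : lead (-a) = -lead a := by
  have := val_lead (-a) (val a) (-upart a) (by
    push_cast
    conv_lhs => rw [eq_upart a]
    ring)
  ext
  rw [this.2]
  simp [lead_coe]

theorem sum_lt {a b c : ℚ_[p]ˣ} (h : (c : ℚ_[p]) = a + b) (hlt : val a < val b) :
    val c = val a ∧ lead c = lead a := by
  obtain ⟨n, hn⟩ : ∃ n : ℕ, val b = val a + (n + 1) := ⟨(val b - val a - 1).toNat, by lia⟩
  have key : (p : ℚ_[p]) ^ (val c) * ((upart c : ℤ_[p]) : ℚ_[p]) = (p : ℚ_[p]) ^ (val a) *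
      (((upart a : ℤ_[p]) + (p : ℤ_[p]) ^ (n + 1) * (upart b : ℤ_[p]) : ℤ_[p]) : ℚ_[p]) := by
    rw [← eq_upart, h]
    conv_lhs => rw [eq_upart a, eq_upart b, hn, zpow_add₀ p_ne]
    push_cast
    have : (p : ℚ_[p]) ^ ((n : ℤ) + 1) = (p : ℚ_[p]) ^ (n + 1) := by norm_cast
    rw [this]
    ring
  have ht : PadicInt.toZMod ((upart a : ℤ_[p]) + (p : ℤ_[p]) ^ (n + 1) * (upart b : ℤ_[p])) =
      (lead a : ZMod p) := by
    rw [map_add, map_mul, map_pow, toZMod_p, lead_coe]; simp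
  rcases compare _ _ _ _ key with ⟨h1, h2⟩ | ⟨h1, h2⟩
  · refine ⟨h1, ?_⟩
    ext
    rw [lead_coe, h2, ht]
  · rw [ht] at h2
    exact absurd h2 (lead a).ne_zero

theorem sum_eq {a b c : ℚ_[p]ˣ} (h : (c : ℚ_[p]) = a + b) (he : val a = val b) :
    (val c = val a ∧ (lead c : ZMod p) = lead a + lead b) ∨
      (val a < val c ∧ (lead b) = -lead a) := by
  have key : (p : ℚ_[p]) ^ (val c) * ((upart c : ℤ_[p]) : ℚ_[p]) = (p : ℚ_[p]) ^ (val a) *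
      (((upart a : ℤ_[p]) + (upart b : ℤ_[p]) : ℤ_[p]) : ℚ_[p]) := by
    rw [← eq_upart, h]
    conv_lhs => rw [eq_upart a, eq_upart b, ← he]
    push_cast
    ring
  rcases compare _ _ _ _ key with ⟨h1, h2⟩ | ⟨h1, h2⟩
  · left
    refine ⟨h1, ?_⟩
    rw [lead_coe, h2, map_add]; rfl
  · right
    refine ⟨h1, ?_⟩
    ext
    rw [map_add] at h2
    exact (neg_eq_of_add_eq_zero_right h2).symm

/-- residue on generators -/
noncomputable def res0 (a : ℚ_[p]ˣ) : WG (ZMod p) :=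
  if Odd (val a) then wgen (lead a) else 0

/-- residue homomorphism -/
noncomputable def res (p : ℕ) [Fact p.Prime] : FA ℚ_[p] →+ WG (ZMod p) :=
  FreeAbelianGroup.lift res0

theorem res_gen (a : ℚ_[p]ˣ) : res p (gen a) = res0 a := FreeAbelianGroup.lift_apply_of _ _

theorem res0_sq (a b : ℚ_[p]ˣ) : res0 (a * b ^ 2) = res0 a := by
  have h1 : val (a * b ^ 2) = val a + 2 * val b := by
    rw [pow_two, val_mul, val_mul]; ring
  have h2 : lead (a * b ^ 2) = lead a * lead b ^ 2 := by
    rw [pow_two, lead_mul, lead_mul, pow_two]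
  rw [res0, res0, h1, h2, wgen_sq]
  congr 1
  simp [Int.odd_add]

theorem res0_add_lt {a b c : ℚ_[p]ˣ} (h : (c : ℚ_[p]) = a + b) (hlt : val a < val b) :
    res0 a + res0 b = res0 c + res0 (a * b * c) := by
  obtain ⟨h1, h2⟩ := sum_lt h hlt
  have e1 : val (a * b * c) = val b + 2 * val a := by
    rw [val_mul, val_mul, h1]; ring
  have e2 : lead (a * b * c) = lead b * lead a ^ 2 := by
    rw [lead_mul, lead_mul, h2, pow_two]
    rw [mul_comm (lead a), mul_assoc]
  have e3 : res0 c = res0 a := by rw [res0, res0, h1, h2]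
  have e4 : res0 (a * b * c) = res0 b := by
    rw [res0, res0, e1, e2, wgen_sq]
    congr 1
    simp [Int.odd_add]
  rw [e3, e4]

theorem res0_add {a b c : ℚ_[p]ˣ} (h : (c : ℚ_[p]) = a + b) :
    res0 a + res0 b = res0 c + res0 (a * b * c) := by
  rcases lt_trichotomy (val a) (val b) with hlt | heq | hgt
  · exact res0_add_lt h hlt
  · have e1 : val (a * b * c) = val c + 2 * val a := by
      rw [val_mul, val_mul, ← heq]; ring
    have e2 : lead (a * b * c) = lead a * lead b * lead c := by
      rw [lead_mul, lead_mul]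
    have e5 : Odd (val (a * b * c)) ↔ Odd (val c) := by
      rw [e1]; simp [Int.odd_add]
    have e6 : Odd (val b) ↔ Odd (val a) := by rw [heq]
    rcases sum_eq h heq with ⟨h1, h2⟩ | ⟨h1, h2⟩
    · simp only [res0, e5, e6, h1, e2]
      by_cases ho : Odd (val a)
      · simp only [ho, if_true]
        exact wgen_add _ _ _ h2
      · simp [ho]
    · have e7 : lead (a * b * c) = (-lead c) * lead a ^ 2 := by
        rw [e2, h2, pow_two]
        ext; push_cast; ring
      have e8 : res0 c + res0 (a * b * c) = 0 := by
        simp only [res0, e5, e7, wgen_sq]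
        by_cases ho : Odd (val c)
        · simp only [ho, if_true]; exact wgen_neg _
        · simp [ho]
      have e9 : res0 a + res0 b = 0 := by
        simp only [res0, e6, h2]
        by_cases ho : Odd (val a)
        · simp only [ho, if_true]; exact wgen_neg _
        · simp [ho]
      rw [e8, e9]
  · rw [add_comm (res0 a), mul_comm a b]
    exact res0_add_lt (by rw [h, add_comm]) hgt

theorem res0_hyp (a : ℚ_[p]ˣ) : res0 a + res0 (-a) = 0 := by
  simp only [res0, val_neg, lead_neg]
  by_cases ho : Odd (val a)
  · simp only [ho, if_true]; exact wgen_neg _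
  · simp [ho]

theorem res_rel {x : FA ℚ_[p]} (hx : x ∈ Rel ℚ_[p]) : res p x = 0 := by
  have : Rel ℚ_[p] ≤ (res p).ker := by
    refine Rel_le ?_ ?_ ?_
    · intro a b
      rw [AddMonoidHom.mem_ker, map_sub, res_gen, res_gen, res0_sq, sub_self]
    · intro a b c h
      rw [AddMonoidHom.mem_ker, map_sub, map_sub, map_add, res_gen, res_gen, res_gen, res_gen,
        res0_add h]
      abel
    · intro a
      rw [AddMonoidHom.mem_ker, map_sub, map_sub, map_add, res_gen, res_gen, res_gen, res_gen,
        res0_hyp, sub_sub, res0_hyp, sub_zero]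
  exact this hx

end Local

end GenusStab


namespace GenusStab

/-- functoriality of the free group on units -/
noncomputable def mapFA {F K : Type*} [Field F] [Field K] (f : F →+* K) : FA F →+ FA K :=
  FreeAbelianGroup.map (Units.map f.toMonoidHom)

theorem mapFA_gen {F K : Type*} [Field F] [Field K] (f : F →+* K) (a : Fˣ) :
    mapFA f (gen a) = gen (Units.map f.toMonoidHom a) := FreeAbelianGroup.map_of_apply _

theorem mapFA_rel {F K : Type*} [Field F] [Field K] (f : F →+* K) {x : FA F} (hx : x ∈ Rel F) :
    mapFA f x ∈ Rel K := by
  have : Rel F ≤ (Rel K).comap (mapFA f) := by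
    refine Rel_le ?_ ?_ ?_
    · intro a b
      rw [AddSubgroup.mem_comap, map_sub, mapFA_gen, mapFA_gen, map_mul, map_pow]
      exact Rel.sq _ _
    · intro a b c h
      rw [AddSubgroup.mem_comap, map_sub, map_sub, map_add, mapFA_gen, mapFA_gen, mapFA_gen,
        mapFA_gen, map_mul, map_mul]
      exact Rel.add _ _ _ (by simp [h])
    · intro a
      rw [AddSubgroup.mem_comap, map_sub, map_sub, map_add, mapFA_gen, mapFA_gen, mapFA_gen,
        mapFA_gen, map_one]
      have e : ∀ u : Fˣ, Units.map f.toMonoidHom (-u) = -Units.map f.toMonoidHom u := by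
        intro u; ext; simp
      rw [e, e, map_one]
      exact Rel.hyp _
  exact this hx

/-- units of the rationals supported on small integers -/
def Usub (k : ℕ) : Subgroup ℚˣ :=
  Subgroup.closure {u : ℚˣ | ∃ m : ℤ, |m| ≤ k ∧ (u : ℚ) = m}

theorem Usub_int {k : ℕ} {m : ℤ} (hm : |m| ≤ k) {u : ℚˣ} (hu : (u : ℚ) = m) : u ∈ Usub k :=
  Subgroup.subset_closure ⟨m, hm, hu⟩

theorem Usub_mono {k l : ℕ} (h : k ≤ l) : Usub k ≤ Usub l := by
  refine Subgroup.closure_mono ?_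
  rintro u ⟨m, hm, hu⟩
  exact ⟨m, hm.trans (by exact_mod_cast h), hu⟩

/-- Milnor filtration -/
def Lf (k : ℕ) : AddSubgroup (FA ℚ) :=
  Rel ℚ ⊔ AddSubgroup.closure ((fun u : ℚˣ => (gen u : FA ℚ)) '' (Usub k : Set ℚˣ))

theorem Rel_le_Lf (k : ℕ) : Rel ℚ ≤ Lf k := le_sup_left

theorem gen_mem_Lf {k : ℕ} {u : ℚˣ} (hu : u ∈ Usub k) : gen u ∈ Lf k :=
  AddSubgroup.mem_sup_right (AddSubgroup.subset_closure ⟨u, hu, rfl⟩)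

theorem Lf_le {k : ℕ} {A : AddSubgroup (FA ℚ)} (h1 : Rel ℚ ≤ A) (h2 : ∀ u ∈ Usub k, gen u ∈ A) :
    Lf k ≤ A := by
  refine sup_le h1 ?_
  rw [AddSubgroup.closure_le]
  rintro _ ⟨u, hu, rfl⟩
  exact h2 u hu

theorem Lf_mono {k l : ℕ} (h : k ≤ l) : Lf k ≤ Lf l :=
  Lf_le (Rel_le_Lf l) fun _ hu => gen_mem_Lf (Usub_mono h hu)

/-- scaling -/
def mulBy (u : ℚˣ) : FA ℚ →+ FA ℚ := FreeAbelianGroup.map (· * u)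

theorem mulBy_gen (u a : ℚˣ) : mulBy u (gen a) = gen (a * u) := FreeAbelianGroup.map_of_apply _

theorem mulBy_rel (u : ℚˣ) {x : FA ℚ} (hx : x ∈ Rel ℚ) : mulBy u x ∈ Rel ℚ := by
  have : Rel ℚ ≤ (Rel ℚ).comap (mulBy u) := by
    refine Rel_le ?_ ?_ ?_
    · intro a b
      rw [AddSubgroup.mem_comap, map_sub, mulBy_gen, mulBy_gen, mul_right_comm]
      exact Rel.sq _ _
    · intro a b c h
      rw [AddSubgroup.mem_comap, map_sub, map_sub, map_add, mulBy_gen, mulBy_gen, mulBy_gen,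
        mulBy_gen]
      have h1 := Rel.add (a * u) (b * u) (c * u) (by push_cast; rw [h]; ring)
      have h2 := Rel.sq (a * b * c * u) u
      have e : a * b * c * u * u ^ 2 = a * u * (b * u) * (c * u) := by
        ext; push_cast; ring
      rw [e] at h2
      convert add_mem h1 h2 using 1
      abel
    · intro a
      rw [AddSubgroup.mem_comap, map_sub, map_sub, map_add, mulBy_gen, mulBy_gen, mulBy_gen,
        mulBy_gen, one_mul]
      have h1 := Rel.hyp (a * u)
      have h2 := Rel.hyp u
      have e : ∀ a : ℚˣ, -a * u = -(a * u) := by intro a; ext; push_cast; ring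
      rw [e, e, one_mul]
      convert sub_mem h1 h2 using 1
      abel
  exact this hx

theorem mulBy_Lf {k : ℕ} {u : ℚˣ} (hu : u ∈ Usub k) {x : FA ℚ} (hx : x ∈ Lf k) :
    mulBy u x ∈ Lf k := by
  have : Lf k ≤ (Lf k).comap (mulBy u) := by
    refine Lf_le ?_ ?_
    · intro y hy
      exact Rel_le_Lf k (mulBy_rel u hy)
    · intro v hv
      rw [AddSubgroup.mem_comap, mulBy_gen]
      exact gen_mem_Lf (mul_mem hv hu)
  exact this hx

section step

variable (p : ℕ) [hp : Fact p.Prime]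

/-- the prime as a unit -/
def Pu : ℚˣ := Units.mk0 (p : ℚ) (by exact_mod_cast hp.out.ne_zero)

/-- integer unit -/
def iu (m : ℤ) (hm : m ≠ 0) : ℚˣ := Units.mk0 (m : ℚ) (by exact_mod_cast hm)

theorem key_mul {u v w : ℤ} (hu : u ≠ 0) (hv : v ≠ 0) (hw : w ≠ 0) (hu' : |u| < p) (hv' : |v| < p)
    (hw' : |w| < p) (h : (p : ℤ) ∣ u * v - w) :
    gen (Pu p * iu u hu * iu v hv) - gen (Pu p * iu w hw) ∈ Lf (p - 1) := by
  obtain ⟨r, hr⟩ := h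
  have hp1 := hp.out.one_lt
  have hc : ((p - 1 : ℕ) : ℤ) = p - 1 := by push_cast [hp1.le]; rfl
  by_cases h0 : r = 0
  · have : Pu p * iu u hu * iu v hv = Pu p * iu w hw := by
      ext
      simp only [Pu, iu, Units.val_mul, Units.val_mk0]
      have : u * v = w := by rw [h0] at hr; linarith
      rw [mul_assoc]; congr 1; exact_mod_cast this
    rw [this, sub_self]
    exact zero_mem _
  have hr' : |r| ≤ (p - 1 : ℕ) := by
    rw [hc]
    have h1 : |(p : ℤ) * r| ≤ (p - 1) * (p - 1) + (p - 1) := by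
      rw [← hr]
      calc |u * v - w| ≤ |u * v| + |w| := abs_sub _ _
        _ ≤ _ := by
          rw [abs_mul]
          gcongr <;> lia
    rw [abs_mul, Nat.abs_cast] at h1
    have : (p : ℤ) * |r| ≤ p * (p - 1) := by linarith
    exact le_of_mul_le_mul_left this (by exact_mod_cast hp.out.pos)
  have hadd := Rel.add (Pu p * iu w hw) (Pu p ^ 2 * iu r h0) (Pu p * iu u hu * iu v hv) (by
    simp only [Pu, iu, Units.val_mul, Units.val_mk0, Units.val_pow_eq_pow_val]
    have : ((u * v - w : ℤ) : ℚ) = ((p * r : ℤ) : ℚ) := by rw [hr]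
    push_cast at this
    linear_combination (p : ℚ) * this)
  have hU : iu u hu ∈ Usub (p - 1) := Usub_int (m := u) (by rw [hc]; lia) rfl
  have hV : iu v hv ∈ Usub (p - 1) := Usub_int (m := v) (by rw [hc]; lia) rfl
  have hW : iu w hw ∈ Usub (p - 1) := Usub_int (m := w) (by rw [hc]; lia) rfl
  have hR : iu r h0 ∈ Usub (p - 1) := Usub_int (m := r) hr' rfl
  have hs1 := Rel.sq (iu r h0) (Pu p)
  have hs2 := Rel.sq (iu w hw * iu r h0 * iu u hu * iu v hv) (Pu p ^ 2)
  have e1 : iu r h0 * Pu p ^ 2 = Pu p ^ 2 * iu r h0 := mul_comm _ _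
  have e2 : iu w hw * iu r h0 * iu u hu * iu v hv * (Pu p ^ 2) ^ 2 =
      Pu p * iu w hw * (Pu p ^ 2 * iu r h0) * (Pu p * iu u hu * iu v hv) := by
    ext; push_cast; ring
  rw [e1] at hs1
  rw [e2] at hs2
  have g1 := gen_mem_Lf hR
  have g2 := gen_mem_Lf (mul_mem (mul_mem (mul_mem hW hR) hU) hV)
  have := sub_mem (add_mem (sub_mem g1 g2) (Rel_le_Lf (p-1) (sub_mem hs1 hs2)))
    (Rel_le_Lf (p - 1) hadd)
  convert this using 1
  abel

variable {p}

theorem val_ne (c : (ZMod p)ˣ) : ((c : ZMod p).val : ℤ) ≠ 0 := by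
  have : NeZero p := ⟨hp.out.ne_zero⟩
  intro h
  have h2 : (c : ZMod p).val = 0 := by exact_mod_cast h
  exact c.ne_zero ((ZMod.val_eq_zero _).1 h2)

/-- natural lift of a residue -/
def lu (c : (ZMod p)ˣ) : ℚˣ := iu ((c : ZMod p).val : ℤ) (val_ne c)

/-- map to local units -/
noncomputable abbrev loc (p : ℕ) [Fact p.Prime] : ℚˣ →* ℚ_[p]ˣ :=
  Units.map (Rat.castHom ℚ_[p]).toMonoidHom

theorem loc_int {m : ℤ} {w : ℚˣ} (hw : (w : ℚ) = m) (hm : ¬ (p : ℤ) ∣ m) :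
    val (loc p w) = 0 ∧ (lead (loc p w) : ZMod p) = m := by
  have hu : IsUnit (m : ℤ_[p]) := by
    rw [PadicInt.isUnit_iff]
    have h1 := PadicInt.norm_le_one (m : ℤ_[p])
    have h2 : ¬ ‖(m : ℤ_[p])‖ < 1 := by
      rw [PadicInt.norm_int_lt_one_iff_dvd]; exact hm
    exact le_antisymm h1 (not_lt.1 h2)
  have := val_lead (loc p w) 0 hu.unit (by
    simp [hw])
  refine ⟨this.1, ?_⟩
  rw [this.2]
  simp

theorem not_dvd_of_small {m : ℤ} (h0 : m ≠ 0) (h : |m| < p) : ¬ (p : ℤ) ∣ m := fun hd =>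
  h0 (Int.eq_zero_of_abs_lt_dvd hd h)

theorem lu_spec (c : (ZMod p)ˣ) : val (loc p (lu c)) = 0 ∧ lead (loc p (lu c)) = c := by
  have : NeZero p := ⟨hp.out.ne_zero⟩
  have h0 : ((c : ZMod p).val : ℤ) ≠ 0 := val_ne c
  have h1 : |((c : ZMod p).val : ℤ)| < p := by
    rw [Nat.abs_cast]; exact_mod_cast ZMod.val_lt _
  have := loc_int (p := p) (w := lu c) rfl (not_dvd_of_small h0 h1)
  refine ⟨this.1, ?_⟩
  ext
  rw [this.2]
  simp

theorem lu_mem (c : (ZMod p)ˣ) : lu c ∈ Usub (p - 1) := by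
  have : NeZero p := ⟨hp.out.ne_zero⟩
  refine Usub_int (m := ((c : ZMod p).val : ℤ)) ?_ rfl
  rw [Nat.abs_cast]
  exact_mod_cast Nat.le_sub_one_of_lt (ZMod.val_lt _)

theorem lu_one : lu (1 : (ZMod p)ˣ) = 1 := by
  ext
  have : Fact (1 < p) := ⟨hp.out.one_lt⟩
  simp [lu, iu, ZMod.val_one]

theorem phi_mul {w : ℚˣ} (hw : w ∈ Usub (p - 1)) : val (loc p w) = 0 ∧ ∀ d : (ZMod p)ˣ,
    gen (Pu p * lu d * w) - gen (Pu p * lu (d * lead (loc p w))) ∈ Lf (p - 1) := by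
  have hNe : NeZero p := ⟨hp.out.ne_zero⟩
  have hp1 := hp.out.one_lt
  induction hw using Subgroup.closure_induction with
  | mem w h =>
    obtain ⟨m, hm, hw⟩ := h
    have hm0 : m ≠ 0 := by
      rintro rfl
      exact w.ne_zero (by simpa using hw)
    have hc : ((p - 1 : ℕ) : ℤ) = p - 1 := by push_cast [hp1.le]; rfl
    rw [hc] at hm
    have hm' : |m| < p := by lia
    obtain ⟨h1, h2⟩ := loc_int hw (not_dvd_of_small hm0 hm')
    refine ⟨h1, fun d => ?_⟩
    have hw' : w = iu m hm0 := by ext; exact hw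
    have hv : ∀ c : (ZMod p)ˣ, |((c : ZMod p).val : ℤ)| < p := by
      intro c; rw [Nat.abs_cast]; exact_mod_cast ZMod.val_lt _
    rw [hw']
    refine key_mul p _ hm0 _ (hv _) hm' (hv _) ?_
    rw [← ZMod.intCast_zmod_eq_zero_iff_dvd (b := p)]
    rw [← hw']
    push_cast
    rw [h2]
    simp
  | one =>
    refine ⟨by rw [map_one, val_one], fun d => ?_⟩
    rw [map_one, lead_one, mul_one, mul_one, sub_self]
    exact zero_mem _
  | mul x y hx hy ihx ihy =>
    refine ⟨by rw [map_mul, val_mul, ihx.1, ihy.1, add_zero], fun d => ?_⟩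
    have h1 := mulBy_Lf hy (ihx.2 d)
    rw [map_sub, mulBy_gen, mulBy_gen] at h1
    have h2 := ihy.2 (d * lead (loc p x))
    rw [map_mul, lead_mul, ← mul_assoc, ← mul_assoc]
    convert add_mem h1 h2 using 1
    abel
  | inv x hx ihx =>
    refine ⟨by rw [map_inv, val_inv, ihx.1, neg_zero], fun d => ?_⟩
    have h1 := mulBy_Lf (inv_mem hx) (ihx.2 (d * lead (loc p x⁻¹)))
    rw [map_sub, mulBy_gen, mulBy_gen, map_inv, lead_inv, inv_mul_cancel_right,
      mul_inv_cancel_right] at h1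
    rw [map_inv, lead_inv]
    convert neg_mem h1 using 1
    abel

theorem phi_one {w : ℚˣ} (hw : w ∈ Usub (p - 1)) :
    gen (Pu p * w) - gen (Pu p * lu (lead (loc p w))) ∈ Lf (p - 1) := by
  have := (phi_mul hw).2 1
  rwa [lu_one, one_mul, mul_one] at this

/-- the local-to-global map -/
noncomputable def phi (p : ℕ) [Fact p.Prime] : FA (ZMod p) →+ FA ℚ ⧸ Lf (p - 1) :=
  FreeAbelianGroup.lift (fun c => QuotientAddGroup.mk (gen (Pu p * lu c)))

theorem phi_gen (c : (ZMod p)ˣ) :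
    phi p (gen c) = QuotientAddGroup.mk (gen (Pu p * lu c)) := FreeAbelianGroup.lift_apply_of _ _

theorem mk_eq {k : ℕ} {x y : FA ℚ} :
    (QuotientAddGroup.mk x : FA ℚ ⧸ Lf k) = QuotientAddGroup.mk y ↔ x - y ∈ Lf k := by
  rw [← sub_eq_zero, ← QuotientAddGroup.mk_sub, QuotientAddGroup.eq_zero_iff]

theorem neg_one_mem {k : ℕ} (hk : 1 ≤ k) : (-1 : ℚˣ) ∈ Usub k :=
  Usub_int (m := -1) (by simpa using hk) (by simp)

theorem phi_gen' {w : ℚˣ} (hw : w ∈ Usub (p - 1)) {c : (ZMod p)ˣ} (hc : lead (loc p w) = c) :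
    phi p (gen c) = QuotientAddGroup.mk (gen (Pu p * w)) := by
  rw [phi_gen, eq_comm, mk_eq, ← hc]
  exact phi_one hw

theorem phi_rel : RelW (ZMod p) ≤ (phi p).ker := by
  have hNe : NeZero p := ⟨hp.out.ne_zero⟩
  have hp1 := hp.out.one_lt
  have hc : ((p - 1 : ℕ) : ℤ) = p - 1 := by push_cast [hp1.le]; rfl
  refine RelW_le ?_ ?_ ?_
  · intro a b
    have h1 : lu a * lu b ^ 2 ∈ Usub (p - 1) := mul_mem (lu_mem a) (pow_mem (lu_mem b) 2)
    have h2 : lead (loc p (lu a * lu b ^ 2)) = a * b ^ 2 := by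
      rw [map_mul, lead_mul, pow_two, map_mul, lead_mul, (lu_spec a).2, (lu_spec b).2, pow_two]
    rw [AddMonoidHom.mem_ker, map_sub, phi_gen' h1 h2, phi_gen, ← QuotientAddGroup.mk_sub,
      QuotientAddGroup.eq_zero_iff, ← mul_assoc]
    exact Rel_le_Lf _ (Rel.sq _ _)
  · intro a b c h
    obtain ⟨i, hi⟩ : ∃ i : ℤ, i = (a : ZMod p).val := ⟨_, rfl⟩
    obtain ⟨j, hj⟩ : ∃ j : ℤ, j = (b : ZMod p).val - p := ⟨_, rfl⟩
    have hi0 : (i : ZMod p) = a := by rw [hi]; simp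
    have hj0 : (j : ZMod p) = b := by rw [hj]; simp
    have hij : ((i + j : ℤ) : ZMod p) = c := by push_cast; rw [hi0, hj0, h]
    have ne : ∀ (c : (ZMod p)ˣ) (m : ℤ), (m : ZMod p) = c → m ≠ 0 := by
      rintro c m hm rfl
      exact c.ne_zero (by simpa using hm.symm)
    have hi1 := ne a i hi0
    have hj1 := ne b j hj0
    have hm1 := ne c _ hij
    have hb1 : ((b : ZMod p).val) ≠ 0 := by simpa [ZMod.val_eq_zero] using b.ne_zero
    have va := ZMod.val_lt (a : ZMod p)
    have vb := ZMod.val_lt (b : ZMod p)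
    have hi2 : |i| < p := by rw [abs_lt]; lia
    have hj2 : |j| < p := by rw [abs_lt]; lia
    have hm2 : |i + j| < p := by rw [abs_lt]; lia
    have mem : ∀ (m : ℤ) (h0 : m ≠ 0), |m| < p → iu m h0 ∈ Usub (p - 1) := fun m h0 hm =>
      Usub_int (m := m) (by rw [hc]; lia) rfl
    have ld : ∀ (c : (ZMod p)ˣ) (m : ℤ) (h0 : m ≠ 0), |m| < p → (m : ZMod p) = c →
        lead (loc p (iu m h0)) = c := by
      intro c m h0 hm hmc
      ext
      rw [(loc_int (w := iu m h0) rfl (not_dvd_of_small h0 hm)).2, hmc]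
    have La := ld a i hi1 hi2 hi0
    have Lb := ld b j hj1 hj2 hj0
    have Lc := ld c _ hm1 hm2 hij
    have Ma := mem i hi1 hi2
    have Mb := mem j hj1 hj2
    have Mc := mem _ hm1 hm2
    have h2 : lead (loc p (iu i hi1 * iu j hj1 * iu _ hm1)) = a * b * c := by
      rw [map_mul, lead_mul, map_mul, lead_mul, La, Lb, Lc]
    rw [AddMonoidHom.mem_ker, map_sub, map_sub, map_add, phi_gen' Ma La, phi_gen' Mb Lb,
      phi_gen' Mc Lc, phi_gen' (mul_mem (mul_mem Ma Mb) Mc) h2, ← QuotientAddGroup.mk_add,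
      ← QuotientAddGroup.mk_sub, ← QuotientAddGroup.mk_sub, QuotientAddGroup.eq_zero_iff]
    have r1 := Rel.add (Pu p * iu i hi1) (Pu p * iu j hj1) (Pu p * iu _ hm1) (by
      simp only [Pu, iu, Units.val_mul, Units.val_mk0]; push_cast; ring)
    have r2 := Rel.sq (Pu p * (iu i hi1 * iu j hj1 * iu _ hm1)) (Pu p)
    have e : (Pu p * (iu i hi1 * iu j hj1 * iu _ hm1)) * (Pu p) ^ 2 =
      (Pu p * iu i hi1) * (Pu p * iu j hj1) * (Pu p * iu _ hm1) := by
      ext; push_cast; ring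
    rw [e] at r2
    refine Rel_le_Lf _ ?_
    convert add_mem r1 r2 using 1
    abel
  · intro a
    have n1 : (-1 : ℚˣ) ∈ Usub (p - 1) := neg_one_mem (by lia)
    have h1 : -1 * lu a ∈ Usub (p - 1) := mul_mem n1 (lu_mem a)
    have h2 : lead (loc p (-1 * lu a)) = -a := by
      have : loc p (-1 * lu a) = - loc p (lu a) := by ext; simp
      rw [this, lead_neg, (lu_spec a).2]
    rw [AddMonoidHom.mem_ker, map_add, phi_gen' h1 h2, phi_gen, ← QuotientAddGroup.mk_add,
      QuotientAddGroup.eq_zero_iff]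
    have r := Rel.hyp (Pu p * lu a)
    have e : Pu p * (-1 * lu a) = -(Pu p * lu a) := by ext; push_cast; ring
    rw [e]
    have := add_mem (Rel_le_Lf (p - 1) r) (add_mem (gen_mem_Lf (one_mem (Usub (p - 1))))
      (gen_mem_Lf n1))
    convert this using 1
    abel

/-- descended map -/
noncomputable def phiW (p : ℕ) [Fact p.Prime] : WG (ZMod p) →+ FA ℚ ⧸ Lf (p - 1) :=
  QuotientAddGroup.lift _ (phi p) phi_rel

theorem phiW_wgen (c : (ZMod p)ˣ) : phiW p (wgen c) = phi p (gen c) := rfl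

theorem Usub_prime {u : ℚˣ} (hu : u ∈ Usub p) : ∃ k : ℤ, ∃ w ∈ Usub (p - 1), u = Pu p ^ k * w := by
  have hp1 := hp.out.one_lt
  have hc : ((p - 1 : ℕ) : ℤ) = p - 1 := by push_cast [hp1.le]; rfl
  induction hu using Subgroup.closure_induction with
  | mem u h =>
    obtain ⟨m, hm, hu⟩ := h
    by_cases hlt : |m| < p
    · exact ⟨0, u, Usub_int (m := m) (by rw [hc]; lia) hu, by simp⟩
    · have hmp : |m| = p := by lia
      rcases (abs_eq (by positivity)).1 hmp with h | h
      · exact ⟨1, 1, one_mem _, by ext; simp [hu, h, Pu]⟩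
      · exact ⟨1, -1, neg_one_mem (by lia), by ext; simp [hu, h, Pu]⟩
  | one => exact ⟨0, 1, one_mem _, by simp⟩
  | mul x y _ _ ihx ihy =>
    obtain ⟨k, w, hw, rfl⟩ := ihx
    obtain ⟨l, v, hv, rfl⟩ := ihy
    exact ⟨k + l, w * v, mul_mem hw hv, by rw [zpow_add]; exact mul_mul_mul_comm _ _ _ _⟩
  | inv x _ ihx =>
    obtain ⟨k, w, hw, rfl⟩ := ihx
    exact ⟨-k, w⁻¹, inv_mem hw, by rw [mul_inv, zpow_neg]⟩

theorem phi_res {u : ℚˣ} (hu : u ∈ Usub p) :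
    phiW p (res p (mapFA (Rat.castHom ℚ_[p]) (gen u))) = QuotientAddGroup.mk (gen u) := by
  obtain ⟨k, w, hw, rfl⟩ := Usub_prime hu
  have hP := val_lead (loc p (Pu p)) 1 1 (by simp [Pu])
  have hv : val (loc p (Pu p ^ k * w)) = k := by
    rw [map_mul, val_mul, (phi_mul hw).1, map_zpow, val_zpow, hP.1]; ring
  have hl1 : lead (loc p (Pu p)) = 1 := by ext; rw [hP.2]; simp
  have hl : lead (loc p (Pu p ^ k * w)) = lead (loc p w) := by
    rw [map_mul, lead_mul, map_zpow, lead_zpow, hl1]; simp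
  rw [mapFA_gen, res_gen, res0, hv, hl]
  by_cases hk : Odd k
  · rw [if_pos hk, phiW_wgen, phi_gen' hw rfl, eq_comm, mk_eq]
    obtain ⟨j, rfl⟩ := hk
    have := Rel.sq (Pu p * w) (Pu p ^ j)
    refine Rel_le_Lf _ ?_
    convert this using 3
    rw [zpow_add, zpow_one, mul_comm 2 j, zpow_mul]
    rw [mul_assoc, mul_comm]
    rfl
  · rw [if_neg hk, map_zero, eq_comm, QuotientAddGroup.eq_zero_iff]
    obtain ⟨j, rfl⟩ := Int.not_odd_iff_even.1 hk
    have := Rel.sq w (Pu p ^ j)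
    have e : w * (Pu p ^ j) ^ 2 = Pu p ^ (j + j) * w := by
      rw [zpow_add, mul_comm, pow_two]
    rw [e] at this
    convert add_mem (Rel_le_Lf (p-1) this) (gen_mem_Lf hw) using 1
    abel

theorem step_prime {x : FA ℚ} (hx : x ∈ Lf p) (h : res p (mapFA (Rat.castHom ℚ_[p]) x) = 0) :
    x ∈ Lf (p - 1) := by
  have : Lf p ≤ AddMonoidHom.eqLocus (((phiW p).comp (res p)).comp (mapFA (Rat.castHom ℚ_[p])))
      (QuotientAddGroup.mk' (Lf (p - 1))) := by
    refine Lf_le ?_ ?_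
    · intro y hy
      change phiW p (res p (mapFA (Rat.castHom ℚ_[p]) y)) = QuotientAddGroup.mk y
      rw [res_rel (mapFA_rel _ hy), map_zero, eq_comm, QuotientAddGroup.eq_zero_iff]
      exact Rel_le_Lf _ hy
    · intro u hu
      exact phi_res hu
  have h2 := this hx
  change phiW p (res p (mapFA (Rat.castHom ℚ_[p]) x)) = QuotientAddGroup.mk x at h2
  rw [h, map_zero, eq_comm, QuotientAddGroup.eq_zero_iff] at h2
  exact h2

end step

theorem step_comp {k : ℕ} (hk : 1 ≤ k) (hnp : ¬ (k + 1).Prime) : Lf (k + 1) ≤ Lf k := by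
  refine Lf_le (Rel_le_Lf k) fun u hu => gen_mem_Lf ?_
  revert u
  change Usub (k + 1) ≤ Usub k
  rw [Usub, Subgroup.closure_le]
  rintro u ⟨m, hm, hu⟩
  by_cases hlt : |m| ≤ k
  · exact Usub_int hlt hu
  · have hmp : |m| = (k + 1 : ℕ) := by lia
    obtain ⟨d, hd, hd1, hd2⟩ := Nat.exists_dvd_of_not_prime (by lia) hnp
    obtain ⟨e, he⟩ := hd
    have hd0 : d ≠ 0 := by rintro rfl; simp at he
    have he0 : e ≠ 0 := by rintro rfl; simp at he
    have he1 : e ≠ 1 := by rintro rfl; apply hd2; lia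
    have h2d : 2 ≤ d := by lia
    have h2e : 2 ≤ e := by lia
    have hdk : d ≤ k := by nlinarith
    have hek : e ≤ k := by nlinarith
    have key : ∃ s : ℤ, |s| = 1 ∧ m = s * d * e := by
      rcases (abs_eq (by positivity)).1 hmp with h | h
      · exact ⟨1, by simp, by rw [h, he]; push_cast; ring⟩
      · exact ⟨-1, by simp, by rw [h, he]; push_cast; ring⟩
    obtain ⟨s, hs, hm'⟩ := key
    have hs0 : s ≠ 0 := by rintro rfl; simp at hs
    have : u = iu s hs0 * iu d (by exact_mod_cast hd0) * iu e (by exact_mod_cast he0) := by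
      ext
      rw [hu, hm']
      simp [iu]
    rw [this]
    refine mul_mem (mul_mem ?_ ?_) ?_
    · exact Usub_int (m := s) (by rw [hs]; exact_mod_cast hk) rfl
    · exact Usub_int (m := d) (by rw [Nat.abs_cast]; exact_mod_cast hdk) rfl
    · exact Usub_int (m := e) (by rw [Nat.abs_cast]; exact_mod_cast hek) rfl

theorem gen_exists (u : ℚˣ) : ∃ k : ℕ, u ∈ Usub k := by
  have hn : (u : ℚ).num ≠ 0 := Rat.num_ne_zero.2 u.ne_zero
  have hd : ((u : ℚ).den : ℤ) ≠ 0 := by exact_mod_cast (u : ℚ).den_ne_zero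
  refine ⟨max (u : ℚ).num.natAbs (u : ℚ).den, ?_⟩
  have : u = iu _ hn * (iu _ hd)⁻¹ := by
    ext
    simp only [iu, Units.val_mul, Units.val_mk0, Units.val_inv_eq_inv_val]
    rw [← div_eq_mul_inv]
    exact_mod_cast (Rat.num_div_den (u : ℚ)).symm
  have h2 : iu _ hn * (iu _ hd)⁻¹ ∈ Usub (max (u : ℚ).num.natAbs (u : ℚ).den) := by
   refine mul_mem (Usub_int (m := (u : ℚ).num) ?_ rfl) (inv_mem (Usub_int (m := (u : ℚ).den) ?_ rfl))
   · rw [Int.abs_eq_natAbs]; exact_mod_cast le_max_left _ _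
   · rw [Nat.abs_cast]; exact_mod_cast le_max_right _ _
  rwa [← this] at h2

theorem Lf_exists (x : FA ℚ) : ∃ k : ℕ, x ∈ Lf k := by
  induction x using FreeAbelianGroup.induction_on with
  | zero => exact ⟨0, zero_mem _⟩
  | of u => obtain ⟨k, hk⟩ := gen_exists u; exact ⟨k, gen_mem_Lf hk⟩
  | neg u h => obtain ⟨k, hk⟩ := h; exact ⟨k, neg_mem hk⟩
  | add x y hx hy =>
    obtain ⟨k, hk⟩ := hx
    obtain ⟨l, hl⟩ := hy
    exact ⟨max k l, add_mem (Lf_mono (le_max_left _ _) hk) (Lf_mono (le_max_right _ _) hl)⟩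

theorem Lf_descend (x : FA ℚ)
    (h : ∀ (p : ℕ) [Fact p.Prime], res p (mapFA (Rat.castHom ℚ_[p]) x) = 0) : x ∈ Lf 1 := by
  obtain ⟨k, hk⟩ := Lf_exists x
  induction k with
  | zero => exact Lf_mono (by norm_num) hk
  | succ k ih =>
    rcases Nat.eq_zero_or_pos k with rfl | hpos
    · exact hk
    apply ih
    by_cases hp : (k + 1).Prime
    · have : Fact (k + 1).Prime := ⟨hp⟩
      have h2 := step_prime (p := k + 1) hk (h (k + 1))
      rwa [Nat.add_sub_cancel] at h2
    · exact step_comp hpos hp hk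

/-- dimension -/
def dimFA (F : Type*) [Field F] : FA F →+ ℤ := FreeAbelianGroup.lift (fun _ => 1)

theorem dimFA_gen {F : Type*} [Field F] (a : Fˣ) : dimFA F (gen a) = 1 :=
  FreeAbelianGroup.lift_apply_of _ _

theorem dimFA_rel {F : Type*} [Field F] {x : FA F} (hx : x ∈ Rel F) : dimFA F x = 0 := by
  have : Rel F ≤ (dimFA F).ker := by
    refine Rel_le ?_ ?_ ?_ <;> intros <;> simp [AddMonoidHom.mem_ker, dimFA_gen]
  exact this hx

/-- signature -/
noncomputable def sgnFA : FA ℝ →+ ℤ :=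
  FreeAbelianGroup.lift (fun a : ℝˣ => (SignType.sign (a : ℝ) : ℤ))

theorem sgnFA_gen (a : ℝˣ) : sgnFA (gen a) = (SignType.sign (a : ℝ) : ℤ) :=
  FreeAbelianGroup.lift_apply_of _ _

theorem sgnFA_rel {x : FA ℝ} (hx : x ∈ Rel ℝ) : sgnFA x = 0 := by
  have : Rel ℝ ≤ sgnFA.ker := by
    refine Rel_le ?_ ?_ ?_
    · intro a b
      have hb : (0:ℝ) < b ^ 2 := by have := b.ne_zero; positivity
      simp only [AddMonoidHom.mem_ker, map_sub, sgnFA_gen, Units.val_mul, Units.val_pow_eq_pow_val,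
        sign_mul, sign_pos hb]
      simp
    · intro a b c h
      simp only [AddMonoidHom.mem_ker, map_sub, map_add, sgnFA_gen, Units.val_mul, sign_mul]
      rcases lt_or_gt_of_ne a.ne_zero with ha | ha <;> rcases lt_or_gt_of_ne b.ne_zero with hb | hb
      · have hc : (c : ℝ) < 0 := by rw [h]; linarith
        rw [sign_neg ha, sign_neg hb, sign_neg hc]; rfl
      · rcases lt_or_gt_of_ne c.ne_zero with hc | hc
        · rw [sign_neg ha, sign_pos hb, sign_neg hc]; rfl
        · rw [sign_neg ha, sign_pos hb, sign_pos hc]; rfl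
      · rcases lt_or_gt_of_ne c.ne_zero with hc | hc
        · rw [sign_pos ha, sign_neg hb, sign_neg hc]; rfl
        · rw [sign_pos ha, sign_neg hb, sign_pos hc]; rfl
      · have hc : (0:ℝ) < c := by rw [h]; linarith
        rw [sign_pos ha, sign_pos hb, sign_pos hc]; rfl
    · intro a
      simp only [AddMonoidHom.mem_ker, map_sub, map_add, sgnFA_gen, Units.val_neg, Left.sign_neg,
        Units.val_one, sign_one]
      rcases lt_or_gt_of_ne a.ne_zero with ha | ha
      · rw [sign_neg ha]; rfl
      · rw [sign_pos ha]; rfl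
  exact this hx

theorem Usub_one {u : ℚˣ} (hu : u ∈ Usub 1) : u = 1 ∨ u = -1 := by
  induction hu using Subgroup.closure_induction with
  | mem u h =>
    obtain ⟨m, hm, hu⟩ := h
    have hm0 : m ≠ 0 := by
      rintro rfl
      exact u.ne_zero (by simpa using hu)
    have : m = 1 ∨ m = -1 := by
      rw [abs_le] at hm
      push_cast at hm
      lia
    rcases this with rfl | rfl
    · left; ext; simpa using hu
    · right; ext; simpa using hu
  | one => exact Or.inl rfl
  | mul x y _ _ ihx ihy =>
    rcases ihx with rfl | rfl <;> rcases ihy with rfl | rfl <;> simp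
  | inv x _ ihx =>
    rcases ihx with rfl | rfl <;> simp

theorem Lf_one {x : FA ℚ} (hx : x ∈ Lf 1) :
    ∃ α β : ℤ, x - (α • gen 1 + β • gen (-1)) ∈ Rel ℚ := by
  let A : AddSubgroup (FA ℚ) :=
    { carrier := {x | ∃ α β : ℤ, x - (α • gen 1 + β • gen (-1)) ∈ Rel ℚ}
      zero_mem' := ⟨0, 0, by simp [zero_mem]⟩
      add_mem' := by
        rintro x y ⟨α, β, h⟩ ⟨α', β', h'⟩
        refine ⟨α + α', β + β', ?_⟩
        convert add_mem h h' using 1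
        rw [add_smul, add_smul]; abel
      neg_mem' := by
        rintro x ⟨α, β, h⟩
        refine ⟨-α, -β, ?_⟩
        convert neg_mem h using 1
        rw [neg_smul, neg_smul]; abel }
  have : Lf 1 ≤ A := by
    refine Lf_le ?_ ?_
    · intro y hy
      exact ⟨0, 0, by simpa using hy⟩
    · intro u hu
      rcases Usub_one hu with rfl | rfl
      · exact ⟨1, 0, by simp [zero_mem]⟩
      · exact ⟨0, 1, by simp [zero_mem]⟩
  exact this hx

theorem global_rel {x : FA ℚ}
    (h : ∀ (p : ℕ) [Fact p.Prime], mapFA (Rat.castHom ℚ_[p]) x ∈ Rel ℚ_[p])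
    (hR : mapFA (Rat.castHom ℝ) x ∈ Rel ℝ) : x ∈ Rel ℚ := by
  have h1 := Lf_descend x (fun p _ => res_rel (h p))
  obtain ⟨α, β, hab⟩ := Lf_one h1
  have d1 := dimFA_rel hR
  have s1 := sgnFA_rel hR
  have hab' := mapFA_rel (Rat.castHom ℝ) hab
  have d2 := dimFA_rel hab'
  have s2 := sgnFA_rel hab'
  rw [map_sub, map_sub, d1] at d2
  rw [map_sub, map_sub, s1] at s2
  simp only [map_add, map_zsmul, mapFA_gen, dimFA_gen, sgnFA_gen] at d2 s2
  simp at d2 s2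
  have ha : α = 0 := by lia
  have hb : β = 0 := by lia
  simpa [ha, hb] using hab

theorem mapFA_cls {F K : Type*} [Field F] [Field K] (f : F →+* K) (l : List Fˣ) :
    mapFA f (cls l) = cls (l.map (Units.map f.toMonoidHom)) := by
  induction l with
  | nil => simp
  | cons a l ih => rw [cls_cons, map_add, mapFA_gen, ih, List.map_cons, cls_cons]

theorem global_iso (l l' : List ℚˣ)
    (h : ∀ (p : ℕ) [Fact p.Prime], Iso (l.map (Units.map (Rat.castHom ℚ_[p]).toMonoidHom))
      (l'.map (Units.map (Rat.castHom ℚ_[p]).toMonoidHom)))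
    (hR : Iso (l.map (Units.map (Rat.castHom ℝ).toMonoidHom))
      (l'.map (Units.map (Rat.castHom ℝ).toMonoidHom))) : Iso l l' := by
  apply iso_of_rel
  apply global_rel
  · intro p _
    rw [map_sub, mapFA_cls, mapFA_cls]
    exact rel_of_iso _ _ (h p)
  · rw [map_sub, mapFA_cls, mapFA_cls]
    exact rel_of_iso _ _ hR

end GenusStab


namespace GenusStab

open QuadraticMap

theorem qext {S : Type*} [CommRing S] {n : ℕ} {Q Q' : QuadraticForm S (Fin n → S)}
    (h1 : ∀ i, Q (Pi.single i 1) = Q' (Pi.single i 1))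
    (h2 : ∀ i j, Q (Pi.single i 1 + Pi.single j 1) = Q' (Pi.single i 1 + Pi.single j 1)) :
    Q = Q' := by
  rw [← toQuadraticMap_toBilin Q (Pi.basisFun S (Fin n)),
    ← toQuadraticMap_toBilin Q' (Pi.basisFun S (Fin n))]
  congr 1
  refine (Pi.basisFun S (Fin n)).ext fun i => (Pi.basisFun S (Fin n)).ext fun j => ?_
  rw [toBilin_apply, toBilin_apply]
  simp only [Pi.basisFun_apply, polar, h1, h2]

theorem mat_inv {R : Type*} [CommRing R] {m n : ℕ} (E : (Fin m → R) ≃ₗ[R] (Fin n → R)) :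
    LinearMap.toMatrix' (E : (Fin m → R) →ₗ[R] (Fin n → R)) *
      LinearMap.toMatrix' (E.symm : (Fin n → R) →ₗ[R] (Fin m → R)) = 1 := by
  rw [← LinearMap.toMatrix'_comp, ← LinearMap.toMatrix'_id]
  congr 1
  ext x : 2
  simp

theorem base_change {R S : Type*} [CommRing R] [CommRing S] (f : R →+* S) {m n : ℕ}
    {Q₁ : QuadraticForm R (Fin m → R)} {Q₂ : QuadraticForm R (Fin n → R)}
    {Q₁' : QuadraticForm S (Fin m → S)} {Q₂' : QuadraticForm S (Fin n → S)}
    (h1 : ∀ x, Q₁' (f ∘ x) = f (Q₁ x)) (h2 : ∀ x, Q₂' (f ∘ x) = f (Q₂ x))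
    (h : Q₁.Equivalent Q₂) : Q₁'.Equivalent Q₂' := by
  obtain ⟨e⟩ := h
  let M := LinearMap.toMatrix' (e.toLinearEquiv : (Fin m → R) →ₗ[R] (Fin n → R))
  let N := LinearMap.toMatrix' (e.toLinearEquiv.symm : (Fin n → R) →ₗ[R] (Fin m → R))
  have hMN : M * N = 1 := mat_inv e.toLinearEquiv
  have hNM : N * M = 1 := mat_inv e.toLinearEquiv.symm
  have hMN' : M.map f * N.map f = 1 := by
    rw [← Matrix.map_mul, hMN, Matrix.map_one _ (map_zero f) (map_one f)]
  have hNM' : N.map f * M.map f = 1 := by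
    rw [← Matrix.map_mul, hNM, Matrix.map_one _ (map_zero f) (map_one f)]
  let E : (Fin m → S) ≃ₗ[S] (Fin n → S) := LinearEquiv.ofLinearMap (Matrix.toLin' (M.map f))
    (Matrix.toLin' (N.map f)) (by rw [← Matrix.toLin'_mul, hMN', Matrix.toLin'_one])
    (by rw [← Matrix.toLin'_mul, hNM', Matrix.toLin'_one])
  have key : ∀ x : Fin m → R, E (f ∘ x) = f ∘ (e x) := by
    intro x
    change Matrix.toLin' (M.map f) (f ∘ x) = _
    rw [Matrix.toLin'_apply]
    have : e x = M.mulVec x := by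
      rw [← Matrix.toLin'_apply, Matrix.toLin'_toMatrix']; rfl
    rw [this]
    ext i
    simp [Matrix.mulVec, dotProduct]
  have hQ : Q₂'.comp (E : (Fin m → S) →ₗ[S] (Fin n → S)) = Q₁' := by
    have hx : ∀ x : Fin m → R, Q₂'.comp (E : (Fin m → S) →ₗ[S] (Fin n → S)) (f ∘ x) =
        Q₁' (f ∘ x) := by
      intro x
      rw [QuadraticMap.comp_apply, h1]
      change Q₂' (E (f ∘ x)) = _
      rw [key, h2, e.map_app]
    have hs : ∀ i : Fin m, f ∘ (Pi.single i (1 : R)) = Pi.single i (1 : S) := by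
      intro i
      ext j
      by_cases hij : j = i
      · subst hij; simp
      · simp [hij]
    have hadd : ∀ x y : Fin m → R, f ∘ (x + y) = f ∘ x + f ∘ y := by
      intro x y; ext j; simp
    refine qext ?_ ?_
    · intro i; rw [← hs]; exact hx _
    · intro i j; rw [← hs, ← hs, ← hadd]; exact hx _
  refine ⟨⟨E, fun x => ?_⟩⟩
  rw [← hQ]
  rfl

/-- the integral form as a quadratic form -/
noncomputable def qf (R : Type*) [CommRing R] {n : ℕ} (a : Matrix (Fin n) (Fin n) ℤ) :
    QuadraticForm R (Fin n → R) :=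
  LinearMap.BilinMap.toQuadraticMap
    (Matrix.toLinearMap₂' R (Matrix.of fun i j => if i ≤ j then (a i j : R) else 0))

theorem qf_apply (R : Type*) [CommRing R] {n : ℕ} (a : Matrix (Fin n) (Fin n) ℤ) (x : Fin n → R) :
    qf R a x = QformR R a x := by
  rw [qf, QformR, LinearMap.BilinMap.toQuadraticMap_apply, Matrix.toLinearMap₂'_apply]
  refine Finset.sum_congr rfl fun i _ => Finset.sum_congr rfl fun j _ => ?_
  simp only [Matrix.of_apply, smul_eq_mul]
  split_ifs <;> ring

theorem qf_map {R S : Type*} [CommRing R] [CommRing S] (f : R →+* S) {n : ℕ}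
    (a : Matrix (Fin n) (Fin n) ℤ) (x : Fin n → R) : qf S a (f ∘ x) = f (qf R a x) := by
  rw [qf_apply, qf_apply, QformR, QformR, map_sum]
  refine Finset.sum_congr rfl fun i _ => ?_
  rw [map_sum]
  refine Finset.sum_congr rfl fun j _ => ?_
  split_ifs <;> simp

theorem equivOver_iff (R : Type*) [CommRing R] {n : ℕ} (a b : Matrix (Fin n) (Fin n) ℤ) :
    EquivOver R a b ↔ (qf R a).Equivalent (qf R b) := by
  constructor
  · rintro ⟨g, hg⟩
    refine Equivalent.symm ⟨⟨LinearEquiv.ofLinearMap (Matrix.toLin' (↑(g⁻¹) : Matrix (Fin n) (Fin n) R))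
      (Matrix.toLin' (↑g : Matrix (Fin n) (Fin n) R)) ?_ ?_, fun x => ?_⟩⟩
    · rw [← Matrix.toLin'_mul, ← Units.val_mul, inv_mul_cancel, Units.val_one, Matrix.toLin'_one]
    · rw [← Matrix.toLin'_mul, ← Units.val_mul, mul_inv_cancel, Units.val_one, Matrix.toLin'_one]
    · rw [qf_apply, qf_apply, hg]; rfl
  · rintro ⟨e⟩
    let M := LinearMap.toMatrix' (e.toLinearEquiv : (Fin n → R) →ₗ[R] (Fin n → R))
    let N := LinearMap.toMatrix' (e.toLinearEquiv.symm : (Fin n → R) →ₗ[R] (Fin n → R))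
    refine ⟨⟨M, N, mat_inv e.toLinearEquiv, mat_inv e.toLinearEquiv.symm⟩, fun x => ?_⟩
    change QformR R b x = QformR R a (N.mulVec x)
    rw [← qf_apply, ← qf_apply, ← Matrix.toLin'_apply, Matrix.toLin'_toMatrix']
    have := e.symm.map_app x
    exact this.symm

theorem equivOver_map {R S : Type*} [CommRing R] [CommRing S] (f : R →+* S) {n : ℕ}
    {a b : Matrix (Fin n) (Fin n) ℤ} (h : EquivOver R a b) : EquivOver S a b := by
  rw [equivOver_iff] at h ⊢
  exact base_change f (qf_map f a) (qf_map f b) h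

/-- coordinates on the hyperbolic extension -/
def coord (R : Type*) [CommRing R] (n : ℕ) : ((R × R) × (Fin n → R)) ≃ₗ[R] (Fin (2 + n) → R) where
  toFun v := Fin.append ![v.1.1, v.1.2] v.2
  invFun x := ((x (Fin.castAdd n 0), x (Fin.castAdd n 1)), fun i => x (Fin.natAdd 2 i))
  map_add' v w := by
    ext i
    refine Fin.addCases (fun i => ?_) (fun i => ?_) i
    · fin_cases i <;> simp [Fin.append_left]
    · simp [Fin.append_right]
  map_smul' r v := by
    ext i
    refine Fin.addCases (fun i => ?_) (fun i => ?_) i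
    · fin_cases i <;> simp [Fin.append_left]
    · simp [Fin.append_right]
  left_inv v := by
    ext <;> simp [Fin.append_left, Fin.append_right]
  right_inv x := by
    ext i
    refine Fin.addCases (fun i => ?_) (fun i => ?_) i
    · fin_cases i <;> simp [Fin.append_left]
    · simp [Fin.append_right]

theorem coord_symm_apply (R : Type*) [CommRing R] (n : ℕ) (x : Fin (2 + n) → R) :
    (coord R n).symm x =
      ((x (Fin.castAdd n 0), x (Fin.castAdd n 1)), fun i => x (Fin.natAdd 2 i)) := rfl

theorem coord_apply (R : Type*) [CommRing R] (n : ℕ) (v : (R × R) × (Fin n → R)) :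
    coord R n v = Fin.append ![v.1.1, v.1.2] v.2 := rfl

theorem Hplus_apply (R : Type*) [CommRing R] {n : ℕ} (a : Matrix (Fin n) (Fin n) ℤ)
    (x : Fin (2 + n) → R) : qf R (Hplus a) x = hypSum (qf R a) ((coord R n).symm x) := by
  rw [hypSum_apply, qf_apply, coord_symm_apply, qf_apply, QformR, QformR]
  have h1 : ∀ i j : Fin 2, Hplus a (Fin.castAdd n i) (Fin.castAdd n j) = !![0, 1; 0, 0] i j := by
    intro i j; simp [Hplus]
  have h2 : ∀ (i : Fin 2) (j : Fin n), Hplus a (Fin.castAdd n i) (Fin.natAdd 2 j) = 0 := by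
    intro i j; simp [Hplus]
  have h3 : ∀ (i : Fin n) (j : Fin 2), Hplus a (Fin.natAdd 2 i) (Fin.castAdd n j) = 0 := by
    intro i j; simp [Hplus]
  have h4 : ∀ (i j : Fin n), Hplus a (Fin.natAdd 2 i) (Fin.natAdd 2 j) = a i j := by
    intro i j; simp [Hplus]
  rw [Fin.sum_univ_add]
  simp only [Fin.sum_univ_add, h1, h2, h3, h4]
  congr 1
  · simp [Fin.sum_univ_two]
    intro h
    exact absurd h (by simp [Fin.lt_def])
  · simp

theorem Hplus_equiv (R : Type*) [CommRing R] {n : ℕ} (a : Matrix (Fin n) (Fin n) ℤ) :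
    (qf R (Hplus a)).Equivalent (hypSum (qf R a)) :=
  ⟨⟨(coord R n).symm, fun x => (Hplus_apply R a x).symm⟩⟩

/-- the backward direction, ring by ring -/
theorem local_cancel (R : Type*) [CommRing R] [IsLocalRing R] {n : ℕ}
    {a b : Matrix (Fin n) (Fin n) ℤ} (h : EquivOver ℤ (Hplus a) (Hplus b)) : EquivOver R a b := by
  have h1 := equivOver_map (Int.castRingHom R) h
  rw [equivOver_iff] at h1 ⊢
  exact hyp_cancel _ _ ((Hplus_equiv R a).symm.trans (h1.trans (Hplus_equiv R b)))

theorem qf_separating {n : ℕ} {a : Matrix (Fin n) (Fin n) ℤ} (ha : (gram a).det ≠ 0) :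
    (associated (R := ℚ) (qf ℚ a)).SeparatingLeft := by
  intro x hx
  have hp : ∀ y, polar (qf ℚ a) x y = 0 := by
    intro y
    have := hx y
    rw [associated_apply] at this
    rw [polar]
    simpa using this
  have hg : ∀ i j, polar (qf ℚ a) (Pi.single i 1) (Pi.single j 1) = ((gram a i j : ℤ) : ℚ) := by
    intro i j
    have hs : ∀ i : Fin n, (Int.castRingHom ℚ) ∘ (Pi.single i (1 : ℤ)) = Pi.single i (1 : ℚ) := by
      intro i
      ext j
      by_cases hij : j = i
      · subst hij; simp
      · simp [hij]
    have hadd : ∀ x y : Fin n → ℤ,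
        (Int.castRingHom ℚ) ∘ (x + y) = (Int.castRingHom ℚ) ∘ x + (Int.castRingHom ℚ) ∘ y := by
      intro x y; ext j; simp
    rw [polar, ← hs, ← hs, ← hadd, qf_map, qf_map, qf_map, gram, Matrix.of_apply, Tbil, qf_apply,
      qf_apply, qf_apply]
    simp
  have hM : Matrix.vecMul x ((gram a).map (Int.castRingHom ℚ)) = 0 := by
    ext j
    have h1 := hp (Pi.single j 1)
    have h2 : x = ∑ i, x i • (Pi.single i (1 : ℚ) : Fin n → ℚ) := by
      ext k; simp [Finset.sum_apply, Pi.single_apply]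
    rw [← polarBilin_apply_apply, h2, map_sum, LinearMap.sum_apply] at h1
    simp only [map_smul, LinearMap.smul_apply, polarBilin_apply_apply, hg] at h1
    simpa [Matrix.vecMul, dotProduct] using h1
  have hd : ((gram a).map (Int.castRingHom ℚ)).det ≠ 0 := by
    have := RingHom.map_det (Int.castRingHom ℚ) (gram a)
    rw [RingHom.mapMatrix_apply] at this
    rw [← this]
    simpa using ha
  exact Matrix.eq_zero_of_vecMul_eq_zero hd hM

theorem wss_reindex {F ι κ : Type*} [Field F] [Fintype ι] [Fintype κ] (e : ι ≃ κ) (w : κ → F)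
    (w' : ι → F) (h : ∀ i, w' i = w (e i)) :
    (weightedSumSquares F w').Equivalent (weightedSumSquares F w) := by
  refine Equivalent.symm ⟨⟨LinearEquiv.funCongrLeft F F e, fun x => ?_⟩⟩
  change weightedSumSquares F w' (fun i => x (e i)) = weightedSumSquares F w x
  rw [weightedSumSquares_apply, weightedSumSquares_apply, ← e.sum_comp]
  simp [h]

theorem exists_list {n : ℕ} {a : Matrix (Fin n) (Fin n) ℤ} (ha : (gram a).det ≠ 0) :
    ∃ l : List ℚˣ, (qf ℚ a).Equivalent (D l) := by
  obtain ⟨w, hw⟩ := QuadraticForm.equivalent_weightedSumSquares_units_of_nondegenerate' _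
    (qf_separating ha)
  refine ⟨List.ofFn w, hw.trans ?_⟩
  refine wss_reindex (finCongr (List.length_ofFn).symm) _ _ ?_
  intro i
  simp

theorem list_map {K : Type*} [Field K] (f : ℚ →+* K) {n : ℕ} {a : Matrix (Fin n) (Fin n) ℤ}
    {l : List ℚˣ} (h : (qf ℚ a).Equivalent (D l)) :
    (qf K a).Equivalent (D (l.map (Units.map f.toMonoidHom))) := by
  have h1 : (qf K a).Equivalent
      (weightedSumSquares K (fun i : Fin l.length => f ((l.get i : ℚˣ) : ℚ))) := by
    refine base_change f (qf_map f a) ?_ h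
    intro x
    rw [D_apply, weightedSumSquares_apply, map_sum]
    refine Finset.sum_congr rfl fun i _ => ?_
    rw [map_mul, map_mul]
    rfl
  refine h1.trans ?_
  refine wss_reindex (finCongr (List.length_map _).symm) _ _ ?_
  intro i
  simp only [List.get_eq_getElem, List.getElem_map]
  rfl

theorem rational_equiv {n : ℕ} {a b : Matrix (Fin n) (Fin n) ℤ} (ha : (gram a).det ≠ 0)
    (hb : (gram b).det ≠ 0) (hR : EquivOver ℝ a b)
    (h : ∀ (p : ℕ) [Fact p.Prime], EquivOver ℤ_[p] a b) : EquivOver ℚ a b := by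
  obtain ⟨l, hl⟩ := exists_list ha
  obtain ⟨l', hl'⟩ := exists_list hb
  rw [equivOver_iff]
  refine hl.trans (Equivalent.trans ?_ hl'.symm)
  refine global_iso l l' ?_ ?_
  · intro p _
    have := equivOver_map (algebraMap ℤ_[p] ℚ_[p]) (h p)
    rw [equivOver_iff] at this
    exact (list_map _ hl).symm.trans (this.trans (list_map _ hl'))
  · rw [equivOver_iff] at hR
    exact (list_map _ hl).symm.trans (hR.trans (list_map _ hl'))

end GenusStab


namespace GenusStab

open QuadraticMap

section CD

variable {F V : Type*} [Field F] [AddCommGroup V] [Module F V]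

/-- `r` is the reflection in `v` -/
def IsRefl (Q : QuadraticForm F V) (v : V) (r : V ≃ₗ[F] V) : Prop :=
  ∀ x, r x = x - (polar Q x v / Q v) • v

theorem isRefl_isom {Q : QuadraticForm F V} {v : V} (hv : Q v ≠ 0) {r : V ≃ₗ[F] V}
    (hr : IsRefl Q v r) (x : V) : Q (r x) = Q x := by
  rw [hr, sub_eq_add_neg, QuadraticMap.map_add Q, QuadraticMap.map_neg, polar_neg_right,
    QuadraticMap.map_smul, polar_smul_right]
  simp only [smul_eq_mul]
  field_simp
  ring

theorem cartan_fix [NeZero (2 : F)] (Q : QuadraticForm F V) (G : Subgroup (V ≃ₗ[F] V))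
    (hG : ∀ v, Q v ≠ 0 → ∃ r ∈ G, IsRefl Q v r) (l : List V)
    (hl : ∀ v ∈ l, Q v ≠ 0) (hp : l.Pairwise (fun v w => polar Q v w = 0))
    (σ : V ≃ₗ[F] V) (hσ : ∀ x, Q (σ x) = Q x) :
    ∃ g ∈ G, (∀ x, Q (g x) = Q x) ∧ ∀ v ∈ l, g (σ v) = v := by
  induction l with
  | nil => exact ⟨1, one_mem _, fun x => rfl, by simp⟩
  | cons v l ih =>
    obtain ⟨g, hg, hgi, hgf⟩ := ih (fun v hv => hl v (List.mem_cons_of_mem _ hv))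
      (List.pairwise_cons.1 hp).2
    have hv : Q v ≠ 0 := hl v List.mem_cons_self
    have hvl : ∀ u ∈ l, polar Q u v = 0 := fun u hu => by
      rw [polar_comm]; exact (List.pairwise_cons.1 hp).1 u hu
    obtain ⟨w, hw⟩ : ∃ w, w = g (σ v) := ⟨_, rfl⟩
    have hQw : Q w = Q v := by rw [hw, hgi, hσ]
    have hwl : ∀ u ∈ l, polar Q u w = 0 := by
      intro u hu
      have h1 : polar Q ((g * σ) u) ((g * σ) v) = polar Q u v :=
        isom_polar (g := ((g * σ : V ≃ₗ[F] V) : V →ₗ[F] V)) (fun x => by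
          change Q (g (σ x)) = Q x
          rw [hgi, hσ]) u v
      rw [LinearEquiv.mul_apply, LinearEquiv.mul_apply, hgf u hu, ← hw, hvl u hu] at h1
      exact h1
    have h2 : (2 : F) ≠ 0 := NeZero.ne 2
    have hsum : Q (w - v) + Q (w + v) = 4 * Q v := by
      rw [sub_eq_add_neg, QuadraticMap.map_add Q, QuadraticMap.map_add Q, QuadraticMap.map_neg,
        polar_neg_right, hQw]
      ring
    have fix : ∀ (u s : V) (r : V ≃ₗ[F] V), IsRefl Q s r → polar Q u s = 0 → r u = u := by
      intro u s r hr h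
      rw [hr, h]; simp
    by_cases hm : Q (w - v) = 0
    · have hpl : Q (w + v) ≠ 0 := by
        intro h
        rw [hm, h, add_zero] at hsum
        have : (4 : F) = 2 * 2 := by norm_num
        rw [this] at hsum
        exact (mul_ne_zero (mul_ne_zero h2 h2) hv) hsum.symm
      obtain ⟨r, hr, hr'⟩ := hG _ hpl
      obtain ⟨s, hs, hs'⟩ := hG _ hv
      have hpol : polar Q w (w + v) = Q (w + v) := by
        have := QuadraticMap.map_add Q w v
        rw [polar_add_right, polar_self, this, hQw]; simp; ring
      refine ⟨s * r * g, mul_mem (mul_mem hs hr) hg, fun x => ?_, fun u hu => ?_⟩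
      · rw [LinearEquiv.mul_apply, LinearEquiv.mul_apply, isRefl_isom hv hs', isRefl_isom hpl hr',
          hgi]
      · rw [LinearEquiv.mul_apply, LinearEquiv.mul_apply]
        rcases List.mem_cons.1 hu with rfl | hu
        · rw [← hw, hr' w, hpol, div_self hpl, one_smul, hs']
          have : w - (w + u) = -u := by abel
          rw [this, polar_neg_left, polar_self]
          have : -(2 • Q u) / Q u = -2 := by
            field_simp; simp; ring
          rw [this, neg_smul, two_smul]
          abel
        · rw [hgf u hu, fix u _ r hr' (by rw [polar_add_right, hwl u hu, hvl u hu, add_zero]),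
            fix u _ s hs' (hvl u hu)]
    · obtain ⟨r, hr, hr'⟩ := hG _ hm
      have hpol : polar Q w (w - v) = Q (w - v) := by
        have : Q (w - v) = Q w + Q v - polar Q w v := by
          rw [sub_eq_add_neg, QuadraticMap.map_add Q, QuadraticMap.map_neg, polar_neg_right]; ring
        rw [polar_sub_right, polar_self, this, hQw]; simp; ring
      refine ⟨r * g, mul_mem hr hg, fun x => ?_, fun u hu => ?_⟩
      · rw [LinearEquiv.mul_apply, isRefl_isom hm hr', hgi]
      · rw [LinearEquiv.mul_apply]
        rcases List.mem_cons.1 hu with rfl | hu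
        · rw [← hw, hr' w, hpol, div_self hm, one_smul]
          abel
        · rw [hgf u hu, fix u _ r hr' (by rw [polar_sub_right, hwl u hu, hvl u hu, sub_zero])]

theorem refl_conj {M : Type*} [AddCommGroup M] [Module F M] (Q : QuadraticForm F M)
    {g : ((F × F) × M) ≃ₗ[F] ((F × F) × M)} (hg : g ∈ eoGroup Q) (v : (F × F) × M)
    (h : ∃ r ∈ eoGroup Q, IsRefl (hypSum Q) (g v) r) :
    ∃ r ∈ eoGroup Q, IsRefl (hypSum Q) v r := by
  obtain ⟨r, hr, hr'⟩ := h
  refine ⟨g⁻¹ * r * g, mul_mem (mul_mem (inv_mem hg) hr) hg, fun x => ?_⟩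
  have hi := eoGroup_isom Q hg
  have hpo : polar (hypSum Q) (g x) (g v) = polar (hypSum Q) x v :=
    isom_polar (g := (g : ((F × F) × M) →ₗ[F] ((F × F) × M))) hi x v
  rw [LinearEquiv.mul_apply, LinearEquiv.mul_apply, hr', hi, hpo, ← map_smul, ← map_sub]
  exact g.symm_apply_apply _

theorem refl_plane {M : Type*} [AddCommGroup M] [Module F M] (Q : QuadraticForm F M)
    {x y : F} (hx : x ≠ 0) (hy : y ≠ 0) :
    ∃ r ∈ eoGroup Q, IsRefl (hypSum Q) ((x, y), 0) r := by
  refine ⟨hdiag M (Units.mk0 (-x / y) (div_ne_zero (neg_ne_zero.2 hx) hy)) * hswap F M,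
    mul_mem (hdiag_mem Q _) (hswap_mem Q), fun v => ?_⟩
  rw [LinearEquiv.mul_apply, hdiag_apply, hswap_apply, hypSum_polar, hypSum_apply]
  obtain ⟨⟨a, b⟩, m⟩ := v
  ext
  · simp
    field_simp
    ring
  · simp
    field_simp
    ring
  · simp

theorem refl_y {M : Type*} [AddCommGroup M] [Module F M] (Q : QuadraticForm F M)
    (v : (F × F) × M) (hv : hypSum Q v ≠ 0) (hy : v.1.2 ≠ 0) :
    ∃ r ∈ eoGroup Q, IsRefl (hypSum Q) v r := by
  have hg := eichler_mem Q (-(v.1.2)⁻¹ • v.2)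
  refine refl_conj Q hg v ?_
  have h1 : (eichler Q (-(v.1.2)⁻¹ • v.2) v).2 = 0 := by
    rw [eichler_apply]
    simp [smul_smul, hy]
  have h2 : (eichler Q (-(v.1.2)⁻¹ • v.2) v).1.2 = v.1.2 := rfl
  have h3 := eoGroup_isom Q hg v
  obtain ⟨u, hu⟩ : ∃ u, u = eichler Q (-(v.1.2)⁻¹ • v.2) v := ⟨_, rfl⟩
  rw [← hu] at h1 h2 h3 ⊢
  obtain ⟨⟨x, y⟩, m⟩ := u
  simp only at h1 h2
  subst h1 h2
  refine refl_plane Q ?_ hy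
  rintro rfl
  rw [hypSum_apply] at h3
  apply hv
  rw [← h3]
  simp

theorem refl_mem {M : Type*} [AddCommGroup M] [Module F M] [NeZero (2 : F)] (Q : QuadraticForm F M)
    (v : (F × F) × M) (hv : hypSum Q v ≠ 0) :
    ∃ r ∈ eoGroup Q, IsRefl (hypSum Q) v r := by
  by_cases hy : v.1.2 = 0
  · by_cases hx : v.1.1 = 0
    · have hg := mul_mem (hswap_mem Q) (eichler_mem Q v.2)
      refine refl_conj Q hg v (refl_y Q _ ?_ ?_)
      · rwa [eoGroup_isom Q hg]
      · rw [LinearEquiv.mul_apply, hswap_apply, eichler_apply]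
        simp only [hx, hy, polar_self]
        rw [hypSum_apply, hx, zero_mul, zero_add] at hv
        simp [hv, NeZero.ne (2 : F)]
    · refine refl_conj Q (hswap_mem Q) v (refl_y Q _ ?_ hx)
      rwa [hswap_isom]
  · exact refl_y Q v hv hy

theorem isom_mem_eo {M : Type*} [AddCommGroup M] [Module F M] [NeZero (2 : F)]
    (Q : QuadraticForm F M) (l : List Fˣ) (hl : Q.Equivalent (D l))
    (σ : ((F × F) × M) ≃ₗ[F] ((F × F) × M)) (hσ : ∀ x, hypSum Q (σ x) = hypSum Q x) :
    σ ∈ eoGroup Q := by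
  have hE : (hypSum Q).Equivalent (D (1 :: -1 :: l)) :=
    ((Equivalent.refl _).prod hl).trans (D_hyp 1 l).symm
  obtain ⟨m, hm⟩ : ∃ m : List Fˣ, m = 1 :: -1 :: l := ⟨_, rfl⟩
  rw [← hm] at hE
  obtain ⟨e⟩ := hE
  let b : Fin m.length → (F × F) × M := fun i => e.symm (Pi.single i 1)
  have hb : ∀ i, hypSum Q (b i) = (m.get i : F) := by
    intro i
    have := e.symm.map_app (Pi.single i 1)
    change hypSum Q (b i) = _ at this
    rw [this, D_apply, Finset.sum_eq_single i]
    · simp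
    · intro j _ hj; simp [hj]
    · simp
  have hbo : ∀ i j, i ≠ j → polar (hypSum Q) (b i) (b j) = 0 := by
    intro i j hij
    have h1 : polar (hypSum Q) (b i) (b j) = polar (D m) (Pi.single i 1) (Pi.single j 1) :=
      isom_polar (Q := D m) (Q' := hypSum Q)
        (g := (e.symm.toLinearEquiv : (Fin m.length → F) →ₗ[F] ((F × F) × M)))
        (fun x => e.symm.map_app x) (Pi.single i 1) (Pi.single j 1)
    rw [h1, polar, D_apply, D_apply, D_apply, ← Finset.sum_sub_distrib, ← Finset.sum_sub_distrib]
    refine Finset.sum_eq_zero fun k _ => ?_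
    by_cases hk : k = i
    · subst hk; simp [hij]
    · simp [hk]
  obtain ⟨g, hg, hgi, hgf⟩ := cartan_fix (hypSum Q) (eoGroup Q) (fun v hv => refl_mem Q v hv)
    (List.ofFn b) (by
      intro v hv
      obtain ⟨i, rfl⟩ := (List.mem_ofFn' _ _).1 hv
      rw [hb]
      exact (m.get i).ne_zero) (by
      rw [List.pairwise_ofFn]
      intro i j hij
      exact hbo i j hij.ne) σ hσ
  have hgs : g * σ = 1 := by
    have h1 : ((g * σ : _ ≃ₗ[F] _) : ((F × F) × M) →ₗ[F] _) ∘ₗ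
        (e.symm.toLinearEquiv : (Fin m.length → F) →ₗ[F] ((F × F) × M)) =
        (e.symm.toLinearEquiv : (Fin m.length → F) →ₗ[F] ((F × F) × M)) := by
      refine (Pi.basisFun F (Fin m.length)).ext fun i => ?_
      rw [Pi.basisFun_apply]
      exact hgf (b i) ((List.mem_ofFn' _ _).2 ⟨i, rfl⟩)
    apply LinearEquiv.ext
    intro x
    have h2 := LinearMap.congr_fun h1 (e x)
    have h3 : e.symm.toLinearEquiv (e x) = x := e.toLinearEquiv.symm_apply_apply x
    simp only [LinearMap.comp_apply, LinearEquiv.coe_coe] at h2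
    rw [h3] at h2
    exact h2
  rw [eq_inv_of_mul_eq_one_right hgs]
  exact inv_mem hg

end CD

end GenusStab


namespace GenusStab

open QuadraticMap

section toGL

variable (R : Type*) [CommRing R] (n : ℕ)

/-- matrix of an automorphism of the hyperbolic extension -/
noncomputable def toGL (σ : ((R × R) × (Fin n → R)) ≃ₗ[R] ((R × R) × (Fin n → R))) :
    GL (Fin (2 + n)) R :=
  ⟨_, _, mat_inv (((coord R n).symm.trans σ).trans (coord R n)),
    mat_inv (((coord R n).symm.trans σ).trans (coord R n)).symm⟩

variable {R n}

theorem toGL_mulVec (σ : ((R × R) × (Fin n → R)) ≃ₗ[R] ((R × R) × (Fin n → R)))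
    (x : Fin (2 + n) → R) :
    (toGL R n σ : Matrix (Fin (2 + n)) (Fin (2 + n)) R).mulVec x =
      coord R n (σ ((coord R n).symm x)) := by
  rw [← Matrix.toLin'_apply]
  change Matrix.toLin' (LinearMap.toMatrix' _) x = _
  rw [Matrix.toLin'_toMatrix']
  rfl

theorem GL_ext {m : ℕ} {g h : GL (Fin m) R}
    (H : ∀ x, (g : Matrix (Fin m) (Fin m) R).mulVec x = (h : Matrix (Fin m) (Fin m) R).mulVec x) :
    g = h := by
  apply Units.ext
  apply Matrix.toLin'.injective
  ext x : 1
  ext i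
  simp [H]

theorem toGL_mul (σ τ : ((R × R) × (Fin n → R)) ≃ₗ[R] ((R × R) × (Fin n → R))) :
    toGL R n (σ * τ) = toGL R n σ * toGL R n τ := by
  apply GL_ext
  intro x
  rw [Units.val_mul, ← Matrix.mulVec_mulVec, toGL_mulVec, toGL_mulVec, toGL_mulVec,
    LinearEquiv.symm_apply_apply]
  rfl

theorem toGL_one : toGL R n 1 = 1 := by
  apply GL_ext
  intro x
  rw [toGL_mulVec]
  simp

theorem toGL_inv (σ : ((R × R) × (Fin n → R)) ≃ₗ[R] ((R × R) × (Fin n → R))) :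
    toGL R n σ⁻¹ = (toGL R n σ)⁻¹ := by
  rw [eq_inv_iff_mul_eq_one, ← toGL_mul, inv_mul_cancel, toGL_one]

theorem toGL_surj (g : GL (Fin (2 + n)) R) : ∃ σ, toGL R n σ = g := by
  let E : (Fin (2 + n) → R) ≃ₗ[R] (Fin (2 + n) → R) :=
    LinearEquiv.ofLinearMap (Matrix.toLin' (g : Matrix _ _ R))
      (Matrix.toLin' ((g⁻¹ : GL (Fin (2 + n)) R) : Matrix _ _ R))
      (by rw [← Matrix.toLin'_mul, ← Units.val_mul, mul_inv_cancel, Units.val_one,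
        Matrix.toLin'_one])
      (by rw [← Matrix.toLin'_mul, ← Units.val_mul, inv_mul_cancel, Units.val_one,
        Matrix.toLin'_one])
  refine ⟨((coord R n).trans E).trans (coord R n).symm, ?_⟩
  apply GL_ext
  intro x
  rw [toGL_mulVec]
  simp only [LinearEquiv.trans_apply, LinearEquiv.apply_symm_apply]
  rfl

theorem toGL_isom_iff (a : Matrix (Fin n) (Fin n) ℤ)
    (σ : ((R × R) × (Fin n → R)) ≃ₗ[R] ((R × R) × (Fin n → R))) :
    (∀ x, qf R (Hplus a) ((toGL R n σ : Matrix _ _ R).mulVec x) = qf R (Hplus a) x) ↔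
      ∀ v, hypSum (qf R a) (σ v) = hypSum (qf R a) v := by
  constructor
  · intro h v
    have := h (coord R n v)
    rw [toGL_mulVec, Hplus_apply, Hplus_apply, LinearEquiv.symm_apply_apply,
      LinearEquiv.symm_apply_apply] at this
    exact this
  · intro h x
    rw [toGL_mulVec, Hplus_apply, Hplus_apply, LinearEquiv.symm_apply_apply, h]

variable {S : Type*} [CommRing S]

/-- base change of vectors -/
def bcW (f : R →+* S) (v : (R × R) × (Fin n → R)) : (S × S) × (Fin n → S) :=
  ((f v.1.1, f v.1.2), f ∘ v.2)

theorem bcW_coord (f : R →+* S) (v : (R × R) × (Fin n → R)) :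
    coord S n (bcW f v) = f ∘ coord R n v := by
  ext i
  rw [coord_apply, Function.comp_apply, coord_apply]
  refine Fin.addCases (fun i => ?_) (fun i => ?_) i
  · fin_cases i <;> simp [Fin.append_left, bcW]
  · simp [Fin.append_right, bcW]

theorem comp_single (f : R →+* S) {m : ℕ} (i : Fin m) :
    f ∘ (Pi.single i (1 : R)) = Pi.single i (1 : S) := by
  ext j
  by_cases hij : j = i
  · subst hij; simp
  · simp [hij]

theorem toGL_map (f : R →+* S) {σ : ((R × R) × (Fin n → R)) ≃ₗ[R] ((R × R) × (Fin n → R))}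
    {σ' : ((S × S) × (Fin n → S)) ≃ₗ[S] ((S × S) × (Fin n → S))}
    (h : ∀ v, σ' (bcW f v) = bcW f (σ v)) :
    Matrix.GeneralLinearGroup.map f (toGL R n σ) = toGL S n σ' := by
  apply Units.ext
  ext i j
  rw [Matrix.GeneralLinearGroup.map_apply]
  have h1 : (toGL R n σ : Matrix _ _ R) i j =
      (toGL R n σ : Matrix _ _ R).mulVec (Pi.single j 1) i := by simp
  have h2 : (toGL S n σ' : Matrix _ _ S) i j =
      (toGL S n σ' : Matrix _ _ S).mulVec (Pi.single j 1) i := by simp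
  rw [h1, h2, toGL_mulVec, toGL_mulVec, ← comp_single f]
  have h3 : (coord S n).symm (f ∘ Pi.single j (1 : R)) =
      bcW f ((coord R n).symm (Pi.single j 1)) := by
    rw [LinearEquiv.symm_apply_eq, bcW_coord, LinearEquiv.apply_symm_apply]
  rw [h3, h, bcW_coord]
  rfl

theorem polar_map (f : R →+* S) (a : Matrix (Fin n) (Fin n) ℤ) (x y : Fin n → R) :
    polar (qf S a) (f ∘ x) (f ∘ y) = f (polar (qf R a) x y) := by
  have hadd : f ∘ (x + y) = f ∘ x + f ∘ y := by ext j; simp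
  rw [polar, polar, ← hadd, qf_map, qf_map, qf_map, map_sub, map_sub]

variable (R) in
/-- Eichler matrices -/
noncomputable def eG (a : Matrix (Fin n) (Fin n) ℤ) (w : Fin n → R) : GL (Fin (2 + n)) R :=
  toGL R n (eichler (qf R a) w)

variable (R n) in
/-- swap matrix -/
noncomputable def sG : GL (Fin (2 + n)) R := toGL R n (hswap R _)

variable (n) in
/-- diagonal matrices -/
noncomputable def dG (t : Rˣ) : GL (Fin (2 + n)) R := toGL R n (hdiag _ t)

theorem eG_map (f : R →+* S) (a : Matrix (Fin n) (Fin n) ℤ) (w : Fin n → R) :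
    Matrix.GeneralLinearGroup.map f (eG R a w) = eG S a (f ∘ w) := by
  refine toGL_map f fun v => ?_
  rw [eichler_apply, eichler_apply]
  simp only [bcW, qf_map, polar_map, map_sub, map_mul]
  refine Prod.ext rfl ?_
  ext i
  simp

theorem sG_map (f : R →+* S) : Matrix.GeneralLinearGroup.map f (sG R n) = sG S n :=
  toGL_map f fun _ => rfl

theorem dG_map (f : R →+* S) (t : Rˣ) :
    Matrix.GeneralLinearGroup.map f (dG n t) = dG n (Units.map f.toMonoidHom t) := by
  refine toGL_map f fun v => ?_
  rw [hdiag_apply, hdiag_apply]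
  simp only [bcW, map_mul]
  rfl

theorem dG_eG (a : Matrix (Fin n) (Fin n) ℤ) (t : Rˣ) (w : Fin n → R) :
    eG R a w * dG n t = dG n t * eG R a (((t⁻¹ : Rˣ) : R) • w) := by
  rw [eG, eG, dG, ← toGL_mul, ← toGL_mul]
  congr 1
  apply LinearEquiv.ext
  intro v
  have ht : (t : R) * ((t⁻¹ : Rˣ) : R) = 1 := by simp
  simp only [LinearEquiv.mul_apply, eichler_apply, hdiag_apply, QuadraticMap.map_smul,
    polar_smul_right, smul_eq_mul, smul_smul]
  refine Prod.ext (Prod.ext ?_ rfl) ?_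
  · simp only
    linear_combination (((t⁻¹ : Rˣ) : R) * v.1.2 * (qf R a) w + polar (qf R a) v.2 w) * ht
  · simp only
    rw [mul_comm]

theorem dG_sG (t : Rˣ) : sG R n * dG n t = dG n t⁻¹ * sG R n := by
  rw [sG, dG, dG, ← toGL_mul, ← toGL_mul]
  congr 1

theorem dG_mul (t s : Rˣ) : (dG n (t * s) : GL (Fin (2 + n)) R) = dG n t * dG n s := by
  rw [dG, dG, dG, hdiag_mul, toGL_mul]

theorem dG_one : (dG n (1 : Rˣ) : GL (Fin (2 + n)) R) = 1 := by
  have := dG_mul (n := n) (1 : Rˣ) 1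
  rw [mul_one] at this
  exact (mul_eq_left.1 this.symm)

theorem eG_inv (a : Matrix (Fin n) (Fin n) ℤ) (w : Fin n → R) :
    (eG R a w)⁻¹ = eG R a (-w) := by
  rw [eG, eG, ← toGL_inv, eichler_inv]

/-- isometry group in matrix form -/
def OG (R : Type*) [CommRing R] (A : Matrix (Fin n) (Fin n) ℤ) : Subgroup (GL (Fin n) R) where
  carrier := {g | ∀ x, qf R A ((g : Matrix _ _ R).mulVec x) = qf R A x}
  one_mem' := by intro x; simp
  mul_mem' := by
    intro g h hg hh x
    rw [Units.val_mul, ← Matrix.mulVec_mulVec, hg, hh]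
  inv_mem' := by
    intro g hg x
    rw [← hg, Matrix.mulVec_mulVec, ← Units.val_mul, mul_inv_cancel]
    simp

theorem mem_OG (A : Matrix (Fin n) (Fin n) ℤ) (g : GL (Fin n) R) :
    g ∈ OG R A ↔ ∀ x, qf R A ((g : Matrix _ _ R).mulVec x) = qf R A x := Iff.rfl

theorem eG_mem (a : Matrix (Fin n) (Fin n) ℤ) (w : Fin n → R) : eG R a w ∈ OG R (Hplus a) :=
  (toGL_isom_iff a _).2 (eichler_isom _ _)

theorem sG_mem (a : Matrix (Fin n) (Fin n) ℤ) : sG R n ∈ OG R (Hplus a) :=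
  (toGL_isom_iff a _).2 (hswap_isom _)

theorem dG_mem (a : Matrix (Fin n) (Fin n) ℤ) (t : Rˣ) : dG n t ∈ OG R (Hplus a) :=
  (toGL_isom_iff a _).2 (hdiag_isom _ t)

end toGL

section local_int

variable (q : ℕ) [hq : Fact q.Prime] (m : ℕ)

/-- integral matrices -/
noncomputable def GZ : Subgroup (GL (Fin m) ℚ_[q]) :=
  (Matrix.GeneralLinearGroup.map (n := Fin m) (algebraMap ℤ_[q] ℚ_[q])).range

variable {q m}

theorem mem_GZ (g : GL (Fin m) ℚ_[q]) : g ∈ GZ q m ↔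
    ∀ i j, ‖(g : Matrix (Fin m) (Fin m) ℚ_[q]) i j‖ ≤ 1 ∧ ‖((g⁻¹ : GL (Fin m) ℚ_[q]) : Matrix (Fin m) (Fin m) ℚ_[q]) i j‖ ≤ 1 := by
  constructor
  · rintro ⟨h, rfl⟩ i j
    rw [← map_inv, Matrix.GeneralLinearGroup.map_apply, Matrix.GeneralLinearGroup.map_apply]
    exact ⟨PadicInt.norm_le_one _, PadicInt.norm_le_one _⟩
  · intro H
    have inj : Function.Injective (fun M : Matrix (Fin m) (Fin m) ℤ_[q] =>
        M.map (algebraMap ℤ_[q] ℚ_[q])) :=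
      Matrix.map_injective (IsFractionRing.injective ℤ_[q] ℚ_[q])
    let A : Matrix (Fin m) (Fin m) ℤ_[q] := fun i j => ⟨_, (H i j).1⟩
    let B : Matrix (Fin m) (Fin m) ℤ_[q] := fun i j => ⟨_, (H i j).2⟩
    have hA : A.map (algebraMap ℤ_[q] ℚ_[q]) = g := rfl
    have hB : B.map (algebraMap ℤ_[q] ℚ_[q]) = (g⁻¹ : GL (Fin m) ℚ_[q]) := rfl
    have h1 : A * B = 1 := by
      apply inj
      change (A * B).map _ = (1 : Matrix _ _ _).map _
      rw [Matrix.map_mul, hA, hB, ← Units.val_mul, mul_inv_cancel,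
        Matrix.map_one _ (map_zero _) (map_one _)]
      rfl
    have h2 : B * A = 1 := by
      apply inj
      change (B * A).map _ = (1 : Matrix _ _ _).map _
      rw [Matrix.map_mul, hA, hB, ← Units.val_mul, inv_mul_cancel,
        Matrix.map_one _ (map_zero _) (map_one _)]
      rfl
    refine ⟨⟨A, B, h1, h2⟩, ?_⟩
    apply Units.ext
    exact hA

theorem GZ_open : IsOpen (GZ q m : Set (GL (Fin m) ℚ_[q])) := by
  have : (GZ q m : Set (GL (Fin m) ℚ_[q])) = ⋂ i : Fin m, ⋂ j : Fin m,
      ({g : GL (Fin m) ℚ_[q] | (g : Matrix (Fin m) (Fin m) ℚ_[q]) i j ∈ Metric.closedBall (0 : ℚ_[q]) 1} ∩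
        {g : GL (Fin m) ℚ_[q] | ((g⁻¹ : GL (Fin m) ℚ_[q]) : Matrix (Fin m) (Fin m) ℚ_[q]) i j ∈
          Metric.closedBall (0 : ℚ_[q]) 1}) := by
    ext g
    simp [mem_GZ]
  rw [this]
  refine isOpen_iInter_of_finite fun i => isOpen_iInter_of_finite fun j => ?_
  have hb : IsOpen (Metric.closedBall (0 : ℚ_[q]) 1) :=
    IsUltrametricDist.isOpen_closedBall _ one_ne_zero
  refine IsOpen.inter (hb.preimage ?_) (hb.preimage ?_)
  · exact Units.continuous_val.matrix_elem i j
  · exact (Units.continuous_val.comp continuous_inv).matrix_elem i j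

end local_int

end GenusStab


namespace GenusStab

open QuadraticMap

section approx

variable {n : ℕ} (a : Matrix (Fin n) (Fin n) ℤ) (p : ℕ) [hp : Fact p.Prime]

/-- rational isometries integral away from `p` -/
noncomputable def Gam : Subgroup (GL (Fin (2 + n)) ℚ) where
  carrier := {g | g ∈ OG ℚ (Hplus a) ∧ ∀ (q : ℕ) [Fact q.Prime], q ≠ p →
    Matrix.GeneralLinearGroup.map (Rat.castHom ℚ_[q]) g ∈ GZ q (2 + n)}
  one_mem' := ⟨one_mem _, fun q _ _ => by rw [map_one]; exact one_mem _⟩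
  mul_mem' := fun {g h} hg hh => ⟨mul_mem hg.1 hh.1, fun q _ hq => by
    rw [map_mul]; exact mul_mem (hg.2 q hq) (hh.2 q hq)⟩
  inv_mem' := fun {g} hg => ⟨inv_mem hg.1, fun q _ hq => by
    rw [map_inv]; exact inv_mem (hg.2 q hq)⟩

/-- closure of the `p`-adic image -/
noncomputable def CC : Subgroup (GL (Fin (2 + n)) ℚ_[p]) :=
  ((Gam a p).map (Matrix.GeneralLinearGroup.map (Rat.castHom ℚ_[p]))).topologicalClosure

variable {a p}

theorem mem_CC {g : GL (Fin (2 + n)) ℚ} (hg : g ∈ Gam a p) :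
    Matrix.GeneralLinearGroup.map (Rat.castHom ℚ_[p]) g ∈ CC a p :=
  Subgroup.le_topologicalClosure _ ⟨g, hg, rfl⟩

theorem sG_CC : sG ℚ_[p] n ∈ CC a p := by
  rw [← sG_map (Rat.castHom ℚ_[p])]
  refine mem_CC ⟨sG_mem a, fun q _ _ => ?_⟩
  rw [sG_map, ← sG_map (algebraMap ℤ_[q] ℚ_[q])]
  exact ⟨_, rfl⟩

variable (p) in
/-- `p` as a unit of the `p`-adic field -/
noncomputable def pu : ℚ_[p]ˣ := Units.mk0 (p : ℚ_[p]) (by exact_mod_cast hp.out.ne_zero)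

theorem dG_CC : dG n (pu p) ∈ CC a p := by
  have hp0 : (p : ℚ) ≠ 0 := by exact_mod_cast hp.out.ne_zero
  have : pu p = Units.map (Rat.castHom ℚ_[p]).toMonoidHom (Units.mk0 (p : ℚ) hp0) := by
    ext; simp [pu]
  rw [this, ← dG_map]
  refine mem_CC ⟨dG_mem a _, fun q hq hqp => ?_⟩
  have hu : IsUnit (p : ℤ_[q]) := by
    rw [PadicInt.isUnit_iff, PadicInt.norm_natCast_eq_one_iff]
    exact (Nat.coprime_primes hq.out hp.out).2 hqp
  have h2 : Units.map (Rat.castHom ℚ_[q]).toMonoidHom (Units.mk0 (p : ℚ) hp0) =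
      Units.map (algebraMap ℤ_[q] ℚ_[q]).toMonoidHom hu.unit := by
    ext; simp
  rw [dG_map, h2, ← dG_map]
  exact ⟨_, rfl⟩

theorem qf_cont (A : Matrix (Fin n) (Fin n) ℤ) : Continuous (qf ℚ_[p] A) := by
  have : (qf ℚ_[p] A : (Fin n → ℚ_[p]) → ℚ_[p]) = fun x => QformR ℚ_[p] A x := by
    funext x; exact qf_apply _ _ _
  rw [this]
  unfold QformR
  refine continuous_finsetSum _ fun i _ => continuous_finsetSum _ fun j _ => ?_
  split_ifs <;> fun_prop

theorem eG_val_cont (A : Matrix (Fin n) (Fin n) ℤ) :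
    Continuous fun w : Fin n → ℚ_[p] =>
      (eG ℚ_[p] A w : Matrix (Fin (2 + n)) (Fin (2 + n)) ℚ_[p]) := by
  refine continuous_matrix fun i j => ?_
  have h1 : ∀ w, (eG ℚ_[p] A w : Matrix (Fin (2 + n)) (Fin (2 + n)) ℚ_[p]) i j =
      coord ℚ_[p] n (eichler (qf ℚ_[p] A) w ((coord ℚ_[p] n).symm (Pi.single j 1))) i := by
    intro w
    rw [← toGL_mulVec]
    simp [eG]
  simp only [h1]
  have hc : Continuous (coord ℚ_[p] n) :=
    LinearMap.continuous_of_finiteDimensional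
      ((coord ℚ_[p] n).toLinearMap)
  refine (continuous_apply i).comp (hc.comp ?_)
  simp only [eichler_apply, polar]
  have := qf_cont (p := p) A
  fun_prop

theorem eG_cont (A : Matrix (Fin n) (Fin n) ℤ) :
    Continuous fun w : Fin n → ℚ_[p] => eG ℚ_[p] A w := by
  rw [Units.continuous_iff]
  refine ⟨eG_val_cont A, ?_⟩
  have : ∀ w : Fin n → ℚ_[p], (((eG ℚ_[p] A w)⁻¹ : GL (Fin (2 + n)) ℚ_[p]) :
      Matrix (Fin (2 + n)) (Fin (2 + n)) ℚ_[p]) = eG ℚ_[p] A (-w) := fun w => by rw [eG_inv]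
  simp only [this]
  exact (eG_val_cont A).comp continuous_neg

theorem eG_int_CC (z : Fin n → ℤ_[p]) : eG ℚ_[p] a (fun i => (z i : ℚ_[p])) ∈ CC a p := by
  have hd : DenseRange (fun (x : Fin n → ℤ) (i : Fin n) => ((x i : ℤ) : ℤ_[p])) :=
    DenseRange.piMap (fun _ => PadicInt.denseRange_intCast)
  refine hd.induction_on (p := fun z : Fin n → ℤ_[p] =>
    eG ℚ_[p] a (fun i => (z i : ℚ_[p])) ∈ CC a p) z ?_ ?_
  · have hcl : IsClosed (CC a p : Set (GL (Fin (2 + n)) ℚ_[p])) :=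
      Subgroup.isClosed_topologicalClosure _
    refine hcl.preimage ((eG_cont a).comp ?_)
    exact continuous_pi fun i => continuous_subtype_val.comp (continuous_apply i)
  · intro x
    have h1 : (fun i => (((x i : ℤ) : ℤ_[p]) : ℚ_[p])) =
        (Rat.castHom ℚ_[p]) ∘ (fun i => ((x i : ℤ) : ℚ)) := by ext i; simp
    rw [h1, ← eG_map]
    refine mem_CC ⟨eG_mem a _, fun q _ _ => ?_⟩
    have h2 : (Rat.castHom ℚ_[q]) ∘ (fun i => ((x i : ℤ) : ℚ)) =
        (algebraMap ℤ_[q] ℚ_[q]) ∘ (fun i => ((x i : ℤ) : ℤ_[q])) := by ext i; simp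
    rw [eG_map, h2, ← eG_map]
    exact ⟨_, rfl⟩

theorem dG_zpow {R : Type*} [CommRing R] (t : Rˣ) (k : ℤ) :
    (dG n (t ^ k) : GL (Fin (2 + n)) R) = dG n t ^ k := by
  let F : Rˣ →* GL (Fin (2 + n)) R := ⟨⟨dG n, dG_one⟩, dG_mul⟩
  exact map_zpow F t k

theorem eG_CC (w : Fin n → ℚ_[p]) : eG ℚ_[p] a w ∈ CC a p := by
  have hk : ∃ k : ℕ, ∀ i, ‖(p : ℚ_[p]) ^ k * w i‖ ≤ 1 := by
    have h0 : ‖(p : ℚ_[p])‖ < 1 := Padic.norm_p_lt_one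
    have : ∀ᶠ k : ℕ in Filter.atTop, ∀ i, ‖(p : ℚ_[p]) ^ k * w i‖ ≤ 1 := by
      rw [Filter.eventually_all]
      intro i
      have ht : Filter.Tendsto (fun k : ℕ => ‖(p : ℚ_[p]) ^ k * w i‖) Filter.atTop
          (nhds 0) := by
        have := (tendsto_pow_atTop_nhds_zero_of_lt_one (norm_nonneg _) h0).mul_const ‖w i‖
        simpa only [norm_mul, norm_pow, zero_mul] using this
      exact ht.eventually_le_const one_pos
    exact this.exists
  obtain ⟨k, hk⟩ := hk
  let z : Fin n → ℤ_[p] := fun i => ⟨_, hk i⟩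
  have h := dG_eG a (pu p ^ (k : ℤ)) (fun i => (z i : ℚ_[p]))
  have hw : ((((pu p ^ (k : ℤ))⁻¹ : ℚ_[p]ˣ)) : ℚ_[p]) • (fun i => (z i : ℚ_[p])) = w := by
    have hp0 : (p : ℚ_[p]) ≠ 0 := by exact_mod_cast hp.out.ne_zero
    ext i
    simp only [z, pu, Pi.smul_apply, smul_eq_mul, zpow_natCast, Units.val_inv_eq_inv_val,
      Units.val_pow_eq_pow_val, Units.val_mk0]
    field_simp
  rw [hw] at h
  have h' : eG ℚ_[p] a w = (dG n (pu p ^ (k : ℤ)))⁻¹ *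
      (eG ℚ_[p] a (fun i => (z i : ℚ_[p])) * dG n (pu p ^ (k : ℤ))) := by
    rw [h, inv_mul_cancel_left]
  have hd : dG n (pu p ^ (k : ℤ)) ∈ CC a p := by
    rw [dG_zpow]; exact zpow_mem dG_CC _
  rw [h']
  exact mul_mem (inv_mem hd) (mul_mem (eG_int_CC z) hd)

/-- unit of the integers as a unit of the field -/
noncomputable def uu (u : ℤ_[p]ˣ) : ℚ_[p]ˣ := Units.map (algebraMap ℤ_[p] ℚ_[p]).toMonoidHom u

theorem dG_uu (u : ℤ_[p]ˣ) : dG n (uu u) ∈ GZ p (2 + n) := by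
  rw [uu, ← dG_map]; exact ⟨_, rfl⟩

theorem mem_T (l : List ℚ_[p]ˣ) (hl : (qf ℚ_[p] a).Equivalent (D l))
    (σ : GL (Fin (2 + n)) ℚ_[p]) (hσ : σ ∈ OG ℚ_[p] (Hplus a)) :
    ∃ u : ℤ_[p]ˣ, ∃ c ∈ CC a p, σ = dG n (uu u) * c := by
  obtain ⟨τ, rfl⟩ := toGL_surj σ
  have hτ := isom_mem_eo (qf ℚ_[p] a) l hl τ ((toGL_isom_iff a τ).1 hσ)
  clear hσ
  have hE : ∀ w (u : ℤ_[p]ˣ) (c : GL (Fin (2 + n)) ℚ_[p]), c ∈ CC a p →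
      ∃ u' : ℤ_[p]ˣ, ∃ c' ∈ CC a p, eG ℚ_[p] a w * (dG n (uu u) * c) = dG n (uu u') * c' := by
    intro w u c hc
    refine ⟨u, _, mul_mem (eG_CC ((((uu u)⁻¹ : ℚ_[p]ˣ) : ℚ_[p]) • w)) hc, ?_⟩
    rw [← mul_assoc, dG_eG, mul_assoc]
  have hS : ∀ (u : ℤ_[p]ˣ) (c : GL (Fin (2 + n)) ℚ_[p]), c ∈ CC a p →
      ∃ u' : ℤ_[p]ˣ, ∃ c' ∈ CC a p, sG ℚ_[p] n * (dG n (uu u) * c) = dG n (uu u') * c' := by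
    intro u c hc
    refine ⟨u⁻¹, _, mul_mem sG_CC hc, ?_⟩
    rw [← mul_assoc, dG_sG, mul_assoc, uu, uu, map_inv]
  have hD : ∀ (t : ℚ_[p]ˣ) (u : ℤ_[p]ˣ) (c : GL (Fin (2 + n)) ℚ_[p]), c ∈ CC a p →
      ∃ u' : ℤ_[p]ˣ, ∃ c' ∈ CC a p, dG n t * (dG n (uu u) * c) = dG n (uu u') * c' := by
    intro t u c hc
    have ht : t = pu p ^ val t * uu (upart t) := by
      ext
      rw [Units.val_mul, Units.val_zpow_eq_zpow_val]
      exact eq_upart t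
    refine ⟨upart t * u, _, mul_mem (zpow_mem dG_CC (val t)) hc, ?_⟩
    rw [← mul_assoc, ← mul_assoc, ← dG_zpow, ← dG_mul, ← dG_mul]
    congr 2
    conv_lhs => rw [ht]
    rw [uu, uu, uu, map_mul]
    rw [mul_assoc, mul_comm]
  refine Subgroup.closure_induction_left (p := fun τ _ => ∃ u : ℤ_[p]ˣ, ∃ c ∈ CC a p,
    toGL ℚ_[p] n τ = dG n (uu u) * c) ?_ ?_ ?_ hτ
  · refine ⟨1, 1, one_mem _, ?_⟩
    rw [toGL_one, uu, map_one, dG_one, mul_one]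
  · rintro x hx y hy ⟨u, c, hc, h⟩
    rw [toGL_mul, h]
    rcases hx with ⟨w, rfl⟩ | hx | ⟨t, rfl⟩
    · exact hE w u c hc
    · rw [Set.mem_singleton_iff.1 hx]
      exact hS u c hc
    · exact hD t u c hc
  · rintro x hx y hy ⟨u, c, hc, h⟩
    rw [toGL_mul, h]
    rcases hx with ⟨w, rfl⟩ | hx | ⟨t, rfl⟩
    · rw [eichler_inv]
      exact hE (-w) u c hc
    · rw [Set.mem_singleton_iff.1 hx, hswap_inv]
      exact hS u c hc
    · rw [hdiag_inv]
      exact hD t⁻¹ u c hc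

theorem approx_p (l : List ℚ_[p]ˣ) (hl : (qf ℚ_[p] a).Equivalent (D l))
    (σ : GL (Fin (2 + n)) ℚ_[p]) (hσ : σ ∈ OG ℚ_[p] (Hplus a)) :
    ∃ γ ∈ Gam a p, σ * (Matrix.GeneralLinearGroup.map (Rat.castHom ℚ_[p]) γ)⁻¹ ∈
      GZ p (2 + n) := by
  obtain ⟨u, c, hc, rfl⟩ := mem_T l hl σ hσ
  have hopen : IsOpen {g : GL (Fin (2 + n)) ℚ_[p] | c * g⁻¹ ∈ GZ p (2 + n)} :=
    GZ_open.preimage (continuous_const.mul continuous_inv)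
  have hc' : c ∈ closure (((Gam a p).map
      (Matrix.GeneralLinearGroup.map (Rat.castHom ℚ_[p])) : Subgroup _) :
        Set (GL (Fin (2 + n)) ℚ_[p])) := hc
  obtain ⟨g, hg, γ, hγ, rfl⟩ := mem_closure_iff.1 hc' _ hopen (by
    change c * c⁻¹ ∈ GZ p (2 + n); rw [mul_inv_cancel]; exact one_mem _)
  refine ⟨γ, hγ, ?_⟩
  rw [mul_assoc]
  exact mul_mem (dG_uu u) hg

end approx

end GenusStab


namespace GenusStab

open QuadraticMap

theorem equivOver_Hplus {R : Type*} [CommRing R] {n : ℕ} {a b : Matrix (Fin n) (Fin n) ℤ}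
    (h : EquivOver R a b) : EquivOver R (Hplus a) (Hplus b) := by
  rw [equivOver_iff] at h ⊢
  refine (Hplus_equiv R a).trans (Equivalent.trans ?_ (Hplus_equiv R b).symm)
  obtain ⟨e⟩ := h
  refine ⟨⟨(LinearEquiv.refl R (R × R)).prodCongr e.toLinearEquiv, fun v => ?_⟩⟩
  change hypSum (qf R b) (v.1, e v.2) = _
  rw [hypSum_apply, hypSum_apply, e.map_app]

/-- matrix isometries between two forms -/
def Iss {R : Type*} [CommRing R] {m : ℕ} (A B : Matrix (Fin m) (Fin m) ℤ) (h : GL (Fin m) R) :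
    Prop := ∀ x, qf R A ((h : Matrix (Fin m) (Fin m) R).mulVec x) = qf R B x

theorem equivOver_iff_Iss {R : Type*} [CommRing R] {m : ℕ} {A B : Matrix (Fin m) (Fin m) ℤ} :
    EquivOver R A B ↔ ∃ h : GL (Fin m) R, Iss A B h := by
  constructor
  · rintro ⟨g, hg⟩
    exact ⟨g⁻¹, fun x => by rw [qf_apply, qf_apply, hg]⟩
  · rintro ⟨h, hh⟩
    refine ⟨h⁻¹, fun x => ?_⟩
    rw [inv_inv, ← qf_apply, ← qf_apply, hh]

theorem Iss_map {R S : Type*} [CommRing R] [CommRing S] (f : R →+* S) {m : ℕ}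
    {A B : Matrix (Fin m) (Fin m) ℤ} {h : GL (Fin m) R} (hh : Iss A B h) :
    Iss A B (Matrix.GeneralLinearGroup.map f h) := by
  have key : ∀ x : Fin m → R, qf S A
      ((Matrix.GeneralLinearGroup.map f h : Matrix (Fin m) (Fin m) S).mulVec (f ∘ x)) =
      qf S B (f ∘ x) := by
    intro x
    have : (Matrix.GeneralLinearGroup.map f h : Matrix (Fin m) (Fin m) S).mulVec (f ∘ x) =
        f ∘ ((h : Matrix (Fin m) (Fin m) R).mulVec x) := by
      ext i
      exact (RingHom.map_mulVec f _ _ _).symm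
    rw [this, qf_map, hh, qf_map]
  have : (qf S A).comp (Matrix.toLin' (Matrix.GeneralLinearGroup.map f h :
      Matrix (Fin m) (Fin m) S)) = qf S B := by
    apply qext
    · intro i
      rw [comp_apply, Matrix.toLin'_apply, ← comp_single f]
      exact key _
    · intro i j
      have hs : (Pi.single i 1 + Pi.single j 1 : Fin m → S) =
          f ∘ (Pi.single i 1 + Pi.single j 1 : Fin m → R) := by
        rw [← comp_single f, ← comp_single f]
        ext k
        simp
      rw [comp_apply, Matrix.toLin'_apply, hs]
      exact key _
  intro x
  rw [← this, comp_apply, Matrix.toLin'_apply]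

section final

variable {n : ℕ} {a b : Matrix (Fin n) (Fin n) ℤ}

/-- local integrality -/
def Good (q : ℕ) [Fact q.Prime] {m : ℕ} (h : GL (Fin m) ℚ) : Prop :=
  Matrix.GeneralLinearGroup.map (Rat.castHom ℚ_[q]) h ∈ GZ q m

theorem step (ha : (gram a).det ≠ 0) (p : ℕ) [Fact p.Prime] (hp : EquivOver ℤ_[p] a b)
    (h : GL (Fin (2 + n)) ℚ) (hh : Iss (Hplus a) (Hplus b) h) :
    ∃ h' : GL (Fin (2 + n)) ℚ, Iss (Hplus a) (Hplus b) h' ∧ Good p h' ∧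
      ∀ (q : ℕ) [Fact q.Prime], q ≠ p → Good q h → Good q h' := by
  obtain ⟨v, hv⟩ := equivOver_iff_Iss.1 (equivOver_Hplus hp)
  have hv' := Iss_map (algebraMap ℤ_[p] ℚ_[p]) hv
  have hvm : Matrix.GeneralLinearGroup.map (algebraMap ℤ_[p] ℚ_[p]) v ∈ GZ p (2 + n) := ⟨v, rfl⟩
  generalize Matrix.GeneralLinearGroup.map (algebraMap ℤ_[p] ℚ_[p]) v = v' at hv' hvm
  have hh' := Iss_map (Rat.castHom ℚ_[p]) hh
  obtain ⟨l, hl⟩ := exists_list ha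
  obtain ⟨γ, hγ, hg⟩ := approx_p _ (list_map (Rat.castHom ℚ_[p]) hl)
    (v' * (Matrix.GeneralLinearGroup.map (Rat.castHom ℚ_[p]) h)⁻¹) (by
      intro x
      rw [Units.val_mul, ← Matrix.mulVec_mulVec, hv', ← hh', Matrix.mulVec_mulVec,
        ← Units.val_mul, mul_inv_cancel, Units.val_one, Matrix.one_mulVec])
  refine ⟨γ * h, ?_, ?_, ?_⟩
  · intro x
    rw [Units.val_mul, ← Matrix.mulVec_mulVec, ← hh]
    exact hγ.1 _
  · have := inv_mem (mul_mem (inv_mem hvm) hg)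
    rw [Good, map_mul]
    convert this using 1
    group
  · intro q _ hq hgood
    rw [Good, map_mul]
    exact mul_mem (hγ.2 q hq) hgood

theorem all_good (ha : (gram a).det ≠ 0) (hp : ∀ (p : ℕ) [Fact p.Prime], EquivOver ℤ_[p] a b)
    (s : Finset ℕ) : ∀ (h : GL (Fin (2 + n)) ℚ), Iss (Hplus a) (Hplus b) h →
    (∀ (q : ℕ) [Fact q.Prime], q ∉ s → Good q h) →
    ∃ h' : GL (Fin (2 + n)) ℚ, Iss (Hplus a) (Hplus b) h' ∧
      ∀ (q : ℕ) [Fact q.Prime], Good q h' := by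
  induction s using Finset.induction_on with
  | empty => exact fun h hh hg => ⟨h, hh, fun q _ => hg q (Finset.notMem_empty q)⟩
  | insert p s hps ih =>
    intro h hh hg
    by_cases hprime : p.Prime
    · haveI := Fact.mk hprime
      obtain ⟨h', hh', h1, h2⟩ := step ha p (hp p) h hh
      refine ih h' hh' fun q hq hqs => ?_
      by_cases hqp : q = p
      · subst hqp
        exact h1
      · exact h2 q hqp (hg q (by simp [hqp, hqs]))
    · refine ih h hh fun q hq hqs => hg q ?_
      have : q ≠ p := fun e => hprime (e ▸ hq.out)
      simp [this, hqs]

theorem good_iff {m : ℕ} (q : ℕ) [hq : Fact q.Prime] (h : GL (Fin m) ℚ) : Good q h ↔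
    ∀ i j, ¬ q ∣ ((h : Matrix (Fin m) (Fin m) ℚ) i j).den ∧
      ¬ q ∣ (((h⁻¹ : GL (Fin m) ℚ) : Matrix (Fin m) (Fin m) ℚ) i j).den := by
  have hr : ∀ r : ℚ, ‖(r : ℚ_[q])‖ ≤ 1 ↔ ¬ q ∣ r.den := by
    intro r
    refine ⟨fun h => ?_, fun h => Padic.norm_rat_le_one h⟩
    have := PadicInt.isUnit_den r h
    rw [PadicInt.isUnit_iff, PadicInt.norm_natCast_eq_one_iff] at this
    exact (Nat.Prime.coprime_iff_not_dvd hq.out).1 this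
  rw [Good, mem_GZ]
  refine forall_congr' fun i => forall_congr' fun j => ?_
  rw [← map_inv, Matrix.GeneralLinearGroup.map_apply, Matrix.GeneralLinearGroup.map_apply]
  exact and_congr (hr _) (hr _)

theorem exists_bad {m : ℕ} (h : GL (Fin m) ℚ) : ∃ s : Finset ℕ,
    ∀ (q : ℕ) [Fact q.Prime], q ∉ s → Good q h := by
  let N : ℕ := ∏ i, ∏ j, ((h : Matrix (Fin m) (Fin m) ℚ) i j).den *
    (((h⁻¹ : GL (Fin m) ℚ) : Matrix (Fin m) (Fin m) ℚ) i j).den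
  have hN : N ≠ 0 := Finset.prod_ne_zero_iff.2 fun i _ => Finset.prod_ne_zero_iff.2 fun j _ =>
    mul_ne_zero (Rat.den_ne_zero _) (Rat.den_ne_zero _)
  refine ⟨N.divisors, fun q _ hq => (good_iff q h).2 fun i j => ?_⟩
  have hd : ((h : Matrix (Fin m) (Fin m) ℚ) i j).den *
    (((h⁻¹ : GL (Fin m) ℚ) : Matrix (Fin m) (Fin m) ℚ) i j).den ∣ N :=
    (Finset.dvd_prod_of_mem (fun j => ((h : Matrix (Fin m) (Fin m) ℚ) i j).den *
      (((h⁻¹ : GL (Fin m) ℚ) : Matrix (Fin m) (Fin m) ℚ) i j).den) (Finset.mem_univ j)).trans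
      (Finset.dvd_prod_of_mem (fun i => ∏ j, ((h : Matrix (Fin m) (Fin m) ℚ) i j).den *
        (((h⁻¹ : GL (Fin m) ℚ) : Matrix (Fin m) (Fin m) ℚ) i j).den) (Finset.mem_univ i))
  rw [Nat.mem_divisors] at hq
  push Not at hq
  exact ⟨fun h1 => hN (hq ((h1.mul_right _).trans hd)),
    fun h1 => hN (hq ((h1.mul_left _).trans hd))⟩

theorem good_int {m : ℕ} (h : GL (Fin m) ℚ) (hg : ∀ (q : ℕ) [Fact q.Prime], Good q h) :
    ∃ H : GL (Fin m) ℤ, Matrix.GeneralLinearGroup.map (Int.castRingHom ℚ) H = h := by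
  have key : ∀ r : ℚ, (∀ q : ℕ, q.Prime → ¬ q ∣ r.den) → ((r.num : ℤ) : ℚ) = r := by
    intro r hr
    apply Rat.coe_int_num_of_den_eq_one
    by_contra hne
    obtain ⟨q, hq, hd⟩ := Nat.exists_prime_and_dvd hne
    exact hr q hq hd
  have hg' : ∀ (q : ℕ), q.Prime → ∀ i j, ¬ q ∣ ((h : Matrix (Fin m) (Fin m) ℚ) i j).den ∧
      ¬ q ∣ (((h⁻¹ : GL (Fin m) ℚ) : Matrix (Fin m) (Fin m) ℚ) i j).den := by
    intro q hq
    haveI := Fact.mk hq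
    exact (good_iff q h).1 (hg q)
  let A : Matrix (Fin m) (Fin m) ℤ := fun i j => ((h : Matrix (Fin m) (Fin m) ℚ) i j).num
  let B : Matrix (Fin m) (Fin m) ℤ := fun i j =>
    (((h⁻¹ : GL (Fin m) ℚ) : Matrix (Fin m) (Fin m) ℚ) i j).num
  have hA : A.map (Int.castRingHom ℚ) = h := by
    ext i j
    exact key _ fun q hq => (hg' q hq i j).1
  have hB : B.map (Int.castRingHom ℚ) = (h⁻¹ : GL (Fin m) ℚ) := by
    ext i j
    exact key _ fun q hq => (hg' q hq i j).2
  have inj : Function.Injective (fun M : Matrix (Fin m) (Fin m) ℤ =>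
      M.map (Int.castRingHom ℚ)) :=
    Matrix.map_injective (RingHom.injective_int _)
  have h1 : A * B = 1 := by
    apply inj
    change (A * B).map _ = (1 : Matrix _ _ _).map _
    rw [Matrix.map_mul, hA, hB, ← Units.val_mul, mul_inv_cancel,
      Matrix.map_one _ (map_zero _) (map_one _)]
    rfl
  have h2 : B * A = 1 := by
    apply inj
    change (B * A).map _ = (1 : Matrix _ _ _).map _
    rw [Matrix.map_mul, hA, hB, ← Units.val_mul, inv_mul_cancel,
      Matrix.map_one _ (map_zero _) (map_one _)]
    rfl
  refine ⟨⟨A, B, h1, h2⟩, ?_⟩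
  apply Units.ext
  exact hA

theorem forward (ha : (gram a).det ≠ 0) (hb : (gram b).det ≠ 0) (hR : EquivOver ℝ a b)
    (hp : ∀ (p : ℕ) [Fact p.Prime], EquivOver ℤ_[p] a b) :
    EquivOver ℤ (Hplus a) (Hplus b) := by
  obtain ⟨h₀, hh₀⟩ := equivOver_iff_Iss.1 (equivOver_Hplus (rational_equiv ha hb hR hp))
  obtain ⟨s, hs⟩ := exists_bad h₀
  obtain ⟨h, hh, hg⟩ := all_good ha hp s h₀ hh₀ hs
  obtain ⟨H, rfl⟩ := good_int h hg
  refine equivOver_iff_Iss.2 ⟨H, fun x => ?_⟩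
  have := hh ((Int.castRingHom ℚ) ∘ x)
  have hm : (Matrix.GeneralLinearGroup.map (Int.castRingHom ℚ) H :
      Matrix (Fin (2 + n)) (Fin (2 + n)) ℚ).mulVec ((Int.castRingHom ℚ) ∘ x) =
        (Int.castRingHom ℚ) ∘ ((H : Matrix (Fin (2 + n)) (Fin (2 + n)) ℤ).mulVec x) := by
    ext i
    exact (RingHom.map_mulVec _ _ _ _).symm
  rw [hm, qf_map, qf_map] at this
  exact RingHom.injective_int (Int.castRingHom ℚ) this

end final

end GenusStab

/-- two nondegenerate integral quadratic forms lie in the same genus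
(equivalent over `ℝ` and over `ℤ_p` for every prime `p`) if and only if `H ⊞ Q₁` and
`H ⊞ Q₂` are `GL_{n+2}(ℤ)`-equivalent. -/
theorem genus_iff_stably_equivalent (n : ℕ) (a b : Matrix (Fin n) (Fin n) ℤ)
    (ha : (gram a).det ≠ 0) (hb : (gram b).det ≠ 0) :
    (EquivOver ℝ a b ∧ ∀ (p : ℕ) [Fact p.Prime], EquivOver ℤ_[p] a b) ↔
      EquivOver ℤ (Hplus a) (Hplus b) := by
  constructor
  · rintro ⟨hR, hp⟩
    exact GenusStab.forward ha hb hR hp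
  · intro h
    exact ⟨GenusStab.local_cancel ℝ h, fun p _ => GenusStab.local_cancel ℤ_[p] h⟩
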